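/- Let 3/4 ≤ c < 1, γ_c^I = √(1 − (3/4)c) − (1/2)√c, and let A_c be the unique smooth solution, with derivatives up to order 10 square-integrable, of (L A_c)' + √c(1 − c) A_c = (e^{−√c x} Q³)'. Then the limit a_c^I := lim_{x→+∞} A_c(x) e^{γ_c^I x} exists and a_c^I ≠ 0. -/

import Mathlib

open Real MeasureTheory Filter

noncomputable def Q (x : ℝ) : ℝ := (5 / (2 * Real.cosh (3 * x / 2) ^ 2)) ^ ((1:ℝ)/3)

/-- The linearized operator `L f = −f'' + f − 4Q³ f`. -/
noncomputable def LQ (f : ℝ → ℝ) : ℝ → ℝ :=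
  fun x => -iteratedDeriv 2 f x + f x - 4 * (Q x) ^ 3 * f x

/-- `A` is the solution of `(L A)' + √c(1−c) A = (e^{−√c x} Q³)'` which is smooth with
square-integrable derivatives up to order 10. -/
noncomputable def IsAc (c : ℝ) (A : ℝ → ℝ) : Prop :=
  ContDiff ℝ (⊤ : ℕ∞) A ∧
  (∀ k : ℕ, k ≤ 10 → Integrable (fun x => (iteratedDeriv k A x) ^ 2)) ∧
  (∀ x : ℝ, deriv (LQ A) x + Real.sqrt c * (1 - c) * A x
    = deriv (fun y => Real.exp (-(Real.sqrt c) * y) * (Q y) ^ 3) x)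

/-! ### Functions controlled by exponentials at `+∞` -/

section ExpDecay

open Asymptotics

/-- `f = O(e^{ax})` at `+∞`. -/
def ExpBigO (f : ℝ → ℝ) (a : ℝ) : Prop := f =O[atTop] fun x => exp (a * x)

variable {f g : ℝ → ℝ} {a b : ℝ}

lemma ExpBigO.mono (hf : ExpBigO f a) (hab : a ≤ b) : ExpBigO f b := by
  refine IsBigO.trans hf (IsBigO.of_bound 1 ?_)
  filter_upwards [eventually_ge_atTop 0] with x hx
  rw [norm_of_nonneg (exp_pos _).le, norm_of_nonneg (exp_pos _).le, one_mul]
  exact exp_le_exp.2 (mul_le_mul_of_nonneg_right hab hx)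

lemma ExpBigO.mul (hf : ExpBigO f a) (hg : ExpBigO g b) :
    ExpBigO (fun x => f x * g x) (a + b) := by
  have h := IsBigO.mul hf hg
  simpa only [ExpBigO, add_mul, exp_add] using h

lemma ExpBigO.add (hf : ExpBigO f a) (hg : ExpBigO g a) : ExpBigO (fun x => f x + g x) a :=
  IsBigO.add hf hg

lemma ExpBigO.sub (hf : ExpBigO f a) (hg : ExpBigO g a) : ExpBigO (fun x => f x - g x) a :=
  IsBigO.sub hf hg

lemma ExpBigO.const_mul (k : ℝ) (hf : ExpBigO f a) : ExpBigO (fun x => k * f x) a :=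
  IsBigO.const_mul_left hf k

lemma expBigO_exp (a : ℝ) : ExpBigO (fun x => exp (a * x)) a := isBigO_refl _ _

lemma expBigO_const (k : ℝ) : ExpBigO (fun _ => k) 0 := by
  simpa [ExpBigO] using isBigO_const_const (l := (atTop : Filter ℝ)) k (one_ne_zero (α := ℝ))

lemma ExpBigO.tendsto_zero (hf : ExpBigO f a) (ha : a < 0) : Tendsto f atTop (nhds 0) := by
  refine IsBigO.trans_tendsto hf ?_
  exact tendsto_exp_atBot.comp (tendsto_id.const_mul_atTop_of_neg ha)

lemma ExpBigO.of_le {C : ℝ} (h : ∀ x, 0 ≤ x → |f x| ≤ C * exp (a * x)) : ExpBigO f a := by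
  refine IsBigO.of_bound C ?_
  filter_upwards [eventually_ge_atTop 0] with x hx
  rw [norm_of_nonneg (exp_pos _).le]
  exact h x hx

lemma ExpBigO.of_tendsto {l : ℝ} (h : Tendsto (fun x => f x * exp (a * x)) atTop (nhds l)) :
    ExpBigO f (-a) := by
  have h1 : ExpBigO (fun x => f x * exp (a * x)) 0 := by
    simpa [ExpBigO] using h.isBigO_one ℝ
  have h2 := h1.mul (expBigO_exp (-a))
  rw [zero_add] at h2
  refine h2.congr_left fun x => ?_
  rw [mul_assoc, ← exp_add]; simp

lemma nonneg_of_deriv_nonpos {φ φ' : ℝ → ℝ} {X : ℝ} (hφ : ∀ x, HasDerivAt φ (φ' x) x)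
    (hφ' : ∀ x, X < x → φ' x ≤ 0) (hφ0 : Tendsto φ atTop (nhds 0)) {x : ℝ} (hx : X ≤ x) :
    0 ≤ φ x := by
  have hanti : AntitoneOn φ (Set.Ici X) := by
    refine antitoneOn_of_deriv_nonpos (convex_Ici X)
      (fun z _ => (hφ z).continuousAt.continuousWithinAt)
      (fun z _ => (hφ z).differentiableAt.differentiableWithinAt) fun z hz => ?_
    rw [interior_Ici] at hz
    rw [(hφ z).deriv]; exact hφ' z hz
  refine le_of_tendsto hφ0 ?_
  filter_upwards [eventually_ge_atTop x] with z hz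
  exact hanti hx (le_trans hx hz) hz

/-- Control of a primitive that tends to `0`. -/
lemma abs_le_of_deriv_abs_le {f f' : ℝ → ℝ} {K a X : ℝ} (ha : 0 < a)
    (hd : ∀ x, HasDerivAt f (f' x) x) (hK : ∀ x, X ≤ x → |f' x| ≤ K * exp (-a * x))
    (h0 : Tendsto f atTop (nhds 0)) : ∀ x, X ≤ x → |f x| ≤ K / a * exp (-a * x) := by
  have he : ∀ x, HasDerivAt (fun x => K / a * exp (-a * x)) (-(K * exp (-a * x))) x := by
    intro x
    have := ((hasDerivAt_id x).const_mul (-a)).exp.const_mul (K / a)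
    refine this.congr_deriv ?_
    simp only [id]; field_simp
  have hl : Tendsto (fun x => K / a * exp (-a * x)) atTop (nhds 0) :=
    ((expBigO_exp (-a)).const_mul (K / a)).tendsto_zero (by linarith)
  intro x hx
  rw [abs_le]
  have h1 := nonneg_of_deriv_nonpos (X := X) (fun x => (he x).add (hd x)) (fun z hz => by
    have := (abs_le.1 (hK z hz.le)).2; linarith)
    (by have := hl.add h0; rw [add_zero] at this; exact this) hx
  have h2 := nonneg_of_deriv_nonpos (X := X) (fun x => (he x).sub (hd x)) (fun z hz => by
    have := (abs_le.1 (hK z hz.le)).1; linarith)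
    (by have := hl.sub h0; rw [sub_zero] at this; exact this) hx
  simp only [Pi.add_apply, Pi.sub_apply] at h1 h2
  constructor <;> linarith

end ExpDecay

/-! ### The ground state -/

/-- The logistic variable `1 / (1 + e^{3x})`, in which `Q³` is polynomial. -/
noncomputable def yv (x : ℝ) : ℝ := 1 / (1 + exp (3 * x))

lemma yv_pos (x : ℝ) : 0 < yv x := by unfold yv; positivity

lemma yv_lt_one (x : ℝ) : yv x < 1 := by
  unfold yv; rw [div_lt_one (by positivity)]; linarith [exp_pos (3 * x)]

lemma yv_zero : yv 0 = 1 / 2 := by unfold yv; norm_num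

lemma yv_le_half {x : ℝ} (hx : 0 ≤ x) : yv x ≤ 1 / 2 := by
  unfold yv
  have : 1 ≤ exp (3 * x) := one_le_exp (by linarith)
  exact one_div_le_one_div_of_le (by norm_num) (by linarith)

lemma yv_neg (x : ℝ) : yv (-x) = 1 - yv x := by
  unfold yv
  have : exp (3 * -x) = (exp (3 * x))⁻¹ := by rw [← exp_neg]; ring_nf
  rw [this]
  have := exp_pos (3 * x)
  field_simp
  ring

lemma yv_eq (x : ℝ) : yv x = (1 - yv x) * exp (-3 * x) := by
  unfold yv
  have : exp (-3 * x) = (exp (3 * x))⁻¹ := by rw [← exp_neg]; ring_nf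
  rw [this]
  have := exp_pos (3 * x)
  field_simp
  ring

lemma yv_le_exp (x : ℝ) : yv x ≤ exp (-3 * x) := by
  have h := yv_eq x
  have := yv_pos x
  nlinarith [exp_pos (-3 * x)]

lemma hasDerivAt_yv (x : ℝ) : HasDerivAt yv (-3 * yv x * (1 - yv x)) x := by
  have h1 : HasDerivAt (fun x => 1 + exp (3 * x)) (3 * exp (3 * x)) x := by
    have := (((hasDerivAt_id x).const_mul 3).exp).const_add 1
    refine this.congr_deriv ?_
    simp only [id]; ring
  have hp : 1 + exp (3 * x) ≠ 0 := by positivity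
  have h2 := h1.inv hp
  have : yv = (fun x => 1 + exp (3 * x))⁻¹ := by
    funext z; simp [yv]
  rw [this]
  refine h2.congr_deriv ?_
  simp only [Pi.inv_apply]
  field_simp
  ring

lemma expBigO_yv : ExpBigO yv (-3) :=
  ExpBigO.of_le (C := 1) fun x _ => by
    rw [abs_of_pos (yv_pos x), one_mul]; exact yv_le_exp x

lemma Q_pos (x : ℝ) : 0 < Q x := by
  unfold Q; have := cosh_pos (3 * x / 2); positivity

lemma Q_cube (x : ℝ) : Q x ^ 3 = 10 * yv x * (1 - yv x) := by
  have hc := cosh_pos (3 * x / 2)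
  have h0 : (0:ℝ) ≤ 5 / (2 * cosh (3 * x / 2) ^ 2) := by positivity
  have h1 : Q x ^ 3 = 5 / (2 * cosh (3 * x / 2) ^ 2) := by
    unfold Q
    rw [← rpow_natCast, ← rpow_mul h0]; norm_num
  have he : exp (3 * x) = exp (3 * x / 2) ^ 2 := by rw [← exp_nat_mul]; congr 1; push_cast; ring
  have hp := exp_pos (3 * x / 2)
  rw [h1, cosh_eq, exp_neg, yv, he]
  field_simp
  ring

lemma hasDerivAt_Q (x : ℝ) : HasDerivAt Q (-(1 - 2 * yv x) * Q x) x := by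
  have hy := yv_pos x
  have hy1 := yv_lt_one x
  have h3 : ∀ z, Q z = (10 * yv z * (1 - yv z)) ^ ((1:ℝ)/3) := by
    intro z
    rw [← Q_cube, ← rpow_natCast, ← rpow_mul (Q_pos z).le]; norm_num
  have hd : HasDerivAt (fun z => 10 * yv z * (1 - yv z))
      (-3 * (1 - 2 * yv x) * (10 * yv x * (1 - yv x))) x := by
    have := ((hasDerivAt_yv x).const_mul 10).mul ((hasDerivAt_yv x).const_sub 1)
    refine this.congr_deriv ?_
    ring
  have hpos : 0 < 10 * yv x * (1 - yv x) := by
    have : 0 < 1 - yv x := by linarith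
    positivity
  have hr := hd.rpow_const (p := (1:ℝ)/3) (Or.inl hpos.ne')
  have hQ : Q = fun z => (10 * yv z * (1 - yv z)) ^ ((1:ℝ)/3) := funext h3
  rw [hQ]
  refine hr.congr_deriv ?_
  have h1 : 1 - yv x ≠ 0 := by linarith
  rw [rpow_sub_one hpos.ne']
  field_simp

lemma Q_le (x : ℝ) : Q x ≤ 3 * exp (-1 * x) := by
  have h : Q x ^ 3 ≤ (3 * exp (-1 * x)) ^ 3 := by
    rw [Q_cube, mul_pow, ← exp_nat_mul]
    have h1 := yv_le_exp x
    have h2 := yv_pos x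
    have h3 : exp (((3:ℕ):ℝ) * (-1 * x)) = exp (-3 * x) := by congr 1; push_cast; ring
    rw [h3]
    nlinarith [exp_pos (-3 * x)]
  exact le_of_pow_le_pow_left₀ (by norm_num) (by positivity) h

lemma le_Q {x : ℝ} (hx : 0 ≤ x) : exp (-1 * x) ≤ Q x := by
  have h : (exp (-1 * x)) ^ 3 ≤ Q x ^ 3 := by
    rw [Q_cube, ← exp_nat_mul]
    have h1 := yv_eq x
    have h2 := yv_le_half hx
    have h3 : exp (((3:ℕ):ℝ) * (-1 * x)) = exp (-3 * x) := by congr 1; push_cast; ring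
    have h4 := yv_pos x
    rw [h3]
    nlinarith [exp_pos (-3 * x)]
  exact le_of_pow_le_pow_left₀ (by norm_num) (Q_pos x).le h

lemma expBigO_Q : ExpBigO Q (-1) :=
  ExpBigO.of_le (C := 3) fun x _ => by rw [abs_of_pos (Q_pos x)]; exact Q_le x

lemma expBigO_Q_inv : ExpBigO (fun x => (Q x)⁻¹) 1 :=
  ExpBigO.of_le (C := 1) fun x hx => by
    rw [abs_of_pos (inv_pos.2 (Q_pos x)), one_mul]
    have := inv_anti₀ (exp_pos _) (le_Q hx)
    rwa [← exp_neg, neg_mul, neg_neg] at this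

/-! ### The dual solution as a power series -/

/-- Coefficients of the solution `e^{-γx} ∑ cₙ yⁿ` of `(L T)' = -(γ - γ³) T`. -/
noncomputable def cf (γ : ℝ) : ℕ → ℝ
  | 0 => 1
  | 1 => -40 * (3 + γ) / (3 * (8 + 9 * γ + 3 * γ ^ 2))
  | n + 2 => ((9 * (n + 1) * (2 * n + 3 + γ) - 40 - 40 * γ / (3 * (n + 2))) * cf γ (n + 1)
      - (9 * (n + 1) * n - 40) * cf γ n)
      / (9 * (n + 2) ^ 2 + 9 * (n + 2) * γ + 3 * γ ^ 2 - 1)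

section Coefficients

variable {γ : ℝ}

lemma cf_one (hγ : 0 < γ) :
    (8 + 9 * γ + 3 * γ ^ 2) * cf γ 1 = -40 * (3 + γ) / 3 := by
  have : 8 + 9 * γ + 3 * γ ^ 2 ≠ 0 := by positivity
  simp only [cf]; field_simp

lemma cf_rec (hγ : 0 < γ) (n : ℕ) :
    (9 * ((n:ℝ) + 2) ^ 2 + 9 * (n + 2) * γ + 3 * γ ^ 2 - 1) * cf γ (n + 2)
      = (9 * (n + 1) * (2 * n + 3 + γ) - 40 - 40 * γ / (3 * (n + 2))) * cf γ (n + 1)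
      - (9 * (n + 1) * n - 40) * cf γ n := by
  have hn : (0:ℝ) ≤ n := n.cast_nonneg
  have : (9 * ((n:ℝ) + 2) ^ 2 + 9 * (n + 2) * γ + 3 * γ ^ 2 - 1) ≠ 0 := by
    have : 0 < 9 * ((n:ℝ) ^ 2 + 4 * n) + 35 + 9 * (n + 2) * γ + 3 * γ ^ 2 := by positivity
    nlinarith
  rw [cf, mul_div_cancel₀ _ this]

/-- If `cₙ` and `n cₙ - (n-1) cₙ₋₁` are bounded by `K` at some index, this persists. -/
lemma cf_box (hγ : 0 < γ) (hγ1 : γ ≤ 1 / 4) {K : ℝ} (h5 : |cf γ 5| ≤ K)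
    (h6 : |6 * cf γ 6 - 5 * cf γ 5| ≤ K) (k : ℕ) :
    |cf γ (k + 5)| ≤ K ∧ |((k:ℝ) + 6) * cf γ (k + 6) - (k + 5) * cf γ (k + 5)| ≤ K := by
  induction k with
  | zero => simpa using ⟨h5, h6⟩
  | succ k ih =>
    obtain ⟨ih1, ih2⟩ := ih
    have hk : (0:ℝ) ≤ k := k.cast_nonneg
    set a := cf γ (k + 5) with ha
    set b := cf γ (k + 6) with hb
    have hr := cf_rec hγ (k + 5)
    rw [show k + 5 + 2 = k + 7 by ring, show k + 5 + 1 = k + 6 by ring, ← ha, ← hb] at hr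
    rw [show k + 1 + 6 = k + 7 by ring]
    set d := cf γ (k + 7) with hd
    push_cast at hr ⊢
    set m := ((k:ℝ) + 6) * b - (k + 5) * a with hm
    rw [abs_le] at ih1 ih2
    have hbK : |b| ≤ K := by
      have h5 : (0:ℝ) ≤ k + 5 := by linarith
      have h6 : (0:ℝ) < k + 6 := by linarith
      have e : (k + 6) * b = (k + 5) * a + m := by rw [hm]; ring
      have hl := mul_le_mul_of_nonneg_left ih1.1 h5
      have hu := mul_le_mul_of_nonneg_left ih1.2 h5
      exact abs_le.2 ⟨le_of_mul_le_mul_left (by linarith) h6,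
        le_of_mul_le_mul_left (by linarith) h6⟩
    refine ⟨hbK, ?_⟩
    -- with `n = k + 7`
    set P := ((k:ℝ) + 7) * (9 * (k + 6) * (k + 5) - 40) + (9 * (k + 7) ^ 2 + 9 * (k + 7) * γ
      + 3 * γ ^ 2 - 1) - ((8 + 9 * γ + 3 * γ ^ 2) * (k + 7) + 40 * γ / 3) with hP
    set An := (9 * ((k:ℝ) + 7) ^ 2 + 9 * (k + 7) * γ + 3 * γ ^ 2 - 1) with hAn
    set R := -((k:ℝ) + 7) * (9 * (k + 6) * (k + 5) - 40)
      + (An - ((8 + 9 * γ + 3 * γ ^ 2) * (k + 7) + 40 * γ / 3)) * (k + 5) with hR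
    have hApos : 0 < An := by
      have e : An = 9 * ((k:ℝ) ^ 2 + 14 * k) + 440 + 9 * (k + 7) * γ + 3 * γ ^ 2 := by
        rw [hAn]; ring
      rw [e]; positivity
    have hg2 : γ ^ 2 ≤ γ / 4 := by nlinarith
    have key : An * (k + 6) * (((k:ℝ) + 1 + 6) * d - (k + 1 + 5) * b) = P * m + R * a := by
      have hk7 : (k:ℝ) + 7 ≠ 0 := by positivity
      have e1 : An * d = (9 * (k + 5 + 1) * (2 * (k + 5) + 3 + γ) - 40
          - 40 * γ / (3 * (k + 5 + 2))) * b - (9 * (k + 5 + 1) * (k + 5) - 40) * a := by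
        rw [← hr, hAn]; ring
      have e2 : 40 * γ / (3 * ((k:ℝ) + 5 + 2)) * (k + 7) = 40 * γ / 3 := by
        rw [show (k:ℝ) + 5 + 2 = k + 7 by ring]; field_simp
      rw [hP, hR, hm]
      linear_combination ((k:ℝ) + 6) * (k + 7) * e1 - ((k:ℝ) + 6) * b * e2
    have hPp : 0 ≤ P := by
      have e : P = ((k:ℝ) + 7) * (9 * k ^ 2 + 108 * k + 284) + (k + 6) * (1 - 3 * γ ^ 2)
          - 40 * γ / 3 := by rw [hP]; ring
      have h1 : 0 ≤ ((k:ℝ) + 6) * (1 - 3 * γ ^ 2) :=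
        mul_nonneg (by linarith) (by linarith)
      have h2 : 0 ≤ (k:ℝ) * (9 * k ^ 2 + 108 * k + 284) + 7 * (9 * k ^ 2 + 108 * k) := by
        positivity
      rw [e]; linarith
    have hPR : P + R ≤ An * (k + 6) := by
      have e : An * (k + 6) - (P + R)
          = ((8 + 9 * γ + 3 * γ ^ 2) * (k + 7) + 40 * γ / 3) * (k + 6) := by
        rw [hP, hR, hAn]; ring
      have : 0 ≤ ((8 + 9 * γ + 3 * γ ^ 2) * ((k:ℝ) + 7) + 40 * γ / 3) * (k + 6) := by positivity
      linarith
    have hPR' : P - R ≤ An * (k + 6) := by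
      have e : An * (k + 6) - (P - R) = (10 + 9 * γ - 3 * γ ^ 2) * ((k:ℝ) + 7) ^ 2
          + (66 - 67 * γ / 3 + 15 * γ ^ 2) * (k + 7) + (4 + 40 * γ - 12 * γ ^ 2) := by
        rw [hP, hR, hAn]; ring
      have h1 : 0 ≤ (10 + 9 * γ - 3 * γ ^ 2) * ((k:ℝ) + 7) ^ 2 :=
        mul_nonneg (by linarith) (sq_nonneg _)
      have h2 : 0 ≤ (66 - 67 * γ / 3 + 15 * γ ^ 2) * ((k:ℝ) + 7) :=
        mul_nonneg (by nlinarith) (by linarith)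
      linarith
    have hpos : 0 < An * (k + 6) := by positivity
    have hK : 0 ≤ K := by linarith
    have h1 : |P * m + R * a| ≤ An * (k + 6) * K := by
      have : |R| ≤ An * (k + 6) - P := by rw [abs_le]; constructor <;> linarith
      calc |P * m + R * a| ≤ |P * m| + |R * a| := abs_add_le _ _
        _ = P * |m| + |R| * |a| := by rw [abs_mul, abs_mul, abs_of_nonneg hPp]
        _ ≤ P * K + (An * (k + 6) - P) * K := by
            gcongr
            · exact abs_le.2 ih2
            · linarith [abs_nonneg R]
            · exact abs_le.2 ih1
        _ = _ := by ring
    rw [← key, abs_mul, abs_of_pos hpos] at h1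
    exact le_of_mul_le_mul_left h1 hpos

lemma cf_bounded (hγ : 0 < γ) (hγ1 : γ ≤ 1 / 4) : ∃ K, 0 < K ∧ ∀ n, |cf γ n| ≤ K := by
  refine ⟨1 + |cf γ 0| + |cf γ 1| + |cf γ 2| + |cf γ 3| + |cf γ 4| + |cf γ 5|
    + |6 * cf γ 6 - 5 * cf γ 5|, by positivity, fun n => ?_⟩
  have h0 := abs_nonneg (cf γ 0)
  have h1 := abs_nonneg (cf γ 1)
  have h2 := abs_nonneg (cf γ 2)
  have h3 := abs_nonneg (cf γ 3)
  have h4 := abs_nonneg (cf γ 4)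
  have h5 := abs_nonneg (cf γ 5)
  have h6 := abs_nonneg (6 * cf γ 6 - 5 * cf γ 5)
  rcases lt_or_ge n 5 with hn | hn
  · interval_cases n <;> linarith
  · obtain ⟨k, rfl⟩ := Nat.exists_eq_add_of_le' hn
    exact (cf_box hγ hγ1 (by linarith) (by linarith) k).1

end Coefficients

/-- `∑ nʲ cₙ yⁿ` at `y = 1 / (1 + e^{3x})`. -/
noncomputable def Es (γ : ℝ) (j : ℕ) (x : ℝ) : ℝ := ∑' n : ℕ, (n:ℝ) ^ j * cf γ n * yv x ^ n

section Series

variable {γ : ℝ}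

lemma summable_Es_bound (K : ℝ) (j : ℕ) {r : ℝ} (h0 : 0 ≤ r) (hr : r < 1) :
    Summable fun n : ℕ => (n:ℝ) ^ j * K * r ^ n := by
  have h := summable_pow_mul_geometric_of_norm_lt_one j
    (show ‖r‖ < 1 by rwa [norm_of_nonneg h0])
  refine (h.mul_left K).congr fun n => by ring

lemma hasSum_Es (hγ : 0 < γ) (hγ1 : γ ≤ 1 / 4) (j : ℕ) (x : ℝ) :
    HasSum (fun n : ℕ => (n:ℝ) ^ j * cf γ n * yv x ^ n) (Es γ j x) := by
  obtain ⟨K, hK, hb⟩ := cf_bounded hγ hγ1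
  refine Summable.hasSum (Summable.of_norm_bounded
    (summable_Es_bound K j (yv_pos x).le (yv_lt_one x)) fun n => ?_)
  rw [norm_mul, norm_mul, norm_of_nonneg (pow_nonneg n.cast_nonneg j),
    norm_of_nonneg (pow_nonneg (yv_pos x).le n)]
  have := hb n
  have := yv_pos x
  gcongr
  assumption

lemma hasDerivAt_Es (hγ : 0 < γ) (hγ1 : γ ≤ 1 / 4) (j : ℕ) (x : ℝ) :
    HasDerivAt (Es γ j) (-3 * (1 - yv x) * Es γ (j + 1) x) x := by
  obtain ⟨K, hK, hb⟩ := cf_bounded hγ hγ1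
  have hanti : ∀ z, x - 1 < z → yv z ≤ yv (x - 1) := fun z hz => by
    unfold yv
    refine one_div_le_one_div_of_le (by positivity) ?_
    have := exp_le_exp.2 (show 3 * (x - 1) ≤ 3 * z by linarith)
    linarith
  have hd : ∀ (n : ℕ) (z : ℝ), HasDerivAt (fun z => (n:ℝ) ^ j * cf γ n * yv z ^ n)
      (-3 * (1 - yv z) * ((n:ℝ) ^ (j + 1) * cf γ n * yv z ^ n)) z := by
    intro n z
    refine (((hasDerivAt_yv z).pow n).const_mul _).congr_deriv ?_
    rcases n with _ | n
    · simp
    · simp only [Nat.add_sub_cancel]; push_cast; ring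
  have h := hasDerivAt_tsum_of_isPreconnected (t := Set.Ioi (x - 1)) (y₀ := x) (y := x)
    (g := fun (n : ℕ) z => (n:ℝ) ^ j * cf γ n * yv z ^ n)
    ((summable_Es_bound K (j + 1) (yv_pos (x - 1)).le (yv_lt_one (x - 1))).mul_left 3)
    isOpen_Ioi isPreconnected_Ioi (fun n z _ => hd n z) (fun n z hz => ?_) (by simp)
    (hasSum_Es hγ hγ1 j x).summable (by simp)
  · refine h.congr_deriv ?_
    rw [tsum_mul_left]; rfl
  · have hz1 := hanti z hz
    have hz0 := yv_pos z
    have hz2 := yv_lt_one z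
    have : |cf γ n| ≤ K := hb n
    rw [norm_mul, norm_mul, norm_mul, norm_mul, norm_of_nonneg (pow_nonneg n.cast_nonneg (j + 1)),
      norm_of_nonneg (pow_nonneg hz0.le n)]
    have h3 : ‖(-3:ℝ)‖ * ‖1 - yv z‖ ≤ 3 := by
      rw [norm_neg, norm_of_nonneg (by linarith : (0:ℝ) ≤ 1 - yv z)]
      norm_num
      linarith
    have : ‖cf γ n‖ ≤ K := hb n
    gcongr

/-- The differential equation in the variable `y`, as a linear relation between the `Es`. -/
lemma Es_relation (hγ : 0 < γ) (hγ1 : γ ≤ 1 / 4) (x : ℝ) :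
    (27 * Es γ 3 x + 27 * γ * Es γ 2 x + 3 * (3 * γ ^ 2 - 1) * Es γ 1 x)
    - yv x * (54 * Es γ 3 x + (81 + 27 * γ) * Es γ 2 x + (27 + 27 * γ - 120) * Es γ 1 x
        - 40 * (3 + γ) * Es γ 0 x)
    + yv x ^ 2 * (27 * Es γ 3 x + 81 * Es γ 2 x + (54 - 120) * Es γ 1 x - 240 * Es γ 0 x) = 0 := by
  have hE := fun j => hasSum_Es hγ hγ1 j x
  set y := yv x
  have hF : HasSum (fun n : ℕ => 3 * (n:ℝ) * (9 * n ^ 2 + 9 * n * γ + 3 * γ ^ 2 - 1)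
      * cf γ n * y ^ n)
      (27 * Es γ 3 x + 27 * γ * Es γ 2 x + 3 * (3 * γ ^ 2 - 1) * Es γ 1 x) := by
    have := (((hE 3).mul_left 27).add ((hE 2).mul_left (27 * γ))).add
      ((hE 1).mul_left (3 * (3 * γ ^ 2 - 1)))
    refine this.congr_fun ?_
    intro n; ring
  have hG : HasSum (fun n : ℕ => (27 * ((n:ℝ) + 1) * n * (2 * n + 1 + γ) - 40 * (3 * n + 3 + γ))
      * cf γ n * y ^ (n + 1))
      (y * (54 * Es γ 3 x + (81 + 27 * γ) * Es γ 2 x + (27 + 27 * γ - 120) * Es γ 1 x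
        - 40 * (3 + γ) * Es γ 0 x)) := by
    have := (((((hE 3).mul_left 54).add ((hE 2).mul_left (81 + 27 * γ))).add
      ((hE 1).mul_left (27 + 27 * γ - 120))).sub ((hE 0).mul_left (40 * (3 + γ)))).mul_left y
    refine this.congr_fun ?_
    intro n; ring
  have hH : HasSum (fun n : ℕ => 3 * ((n:ℝ) + 2) * (9 * (n + 1) * n - 40)
      * cf γ n * y ^ (n + 2))
      (y ^ 2 * (27 * Es γ 3 x + 81 * Es γ 2 x + (54 - 120) * Es γ 1 x - 240 * Es γ 0 x)) := by
    have := (((((hE 3).mul_left 27).add ((hE 2).mul_left 81)).add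
      ((hE 1).mul_left (54 - 120))).sub ((hE 0).mul_left 240)).mul_left (y ^ 2)
    refine this.congr_fun ?_
    intro n; ring
  have hF2 := (hasSum_nat_add_iff' 2).2 hF
  have hG1 := (hasSum_nat_add_iff' 1).2 hG
  have hS := (hF2.sub hG1).add hH
  have h0 : (fun n : ℕ => (3 * ((n + 2 : ℕ):ℝ) * (9 * ((n + 2 : ℕ):ℝ) ^ 2
      + 9 * ((n + 2 : ℕ):ℝ) * γ + 3 * γ ^ 2 - 1) * cf γ (n + 2) * y ^ (n + 2)
      - (27 * (((n + 1 : ℕ):ℝ) + 1) * ((n + 1 : ℕ):ℝ) * (2 * ((n + 1 : ℕ):ℝ) + 1 + γ)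
        - 40 * (3 * ((n + 1 : ℕ):ℝ) + 3 + γ)) * cf γ (n + 1) * y ^ (n + 1 + 1))
      + 3 * ((n:ℝ) + 2) * (9 * (n + 1) * n - 40) * cf γ n * y ^ (n + 2)) = fun _ => 0 := by
    funext n
    have hr := cf_rec hγ n
    have hn : (n:ℝ) + 2 ≠ 0 := by positivity
    have e : 40 * γ / (3 * ((n:ℝ) + 2)) * (3 * (n + 2)) = 40 * γ := by field_simp
    push_cast
    linear_combination 3 * ((n:ℝ) + 2) * y ^ (n + 2) * hr - cf γ (n + 1) * y ^ (n + 2) * e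
  rw [h0] at hS
  have hz := hS.unique hasSum_zero
  simp only [Finset.sum_range_succ, Finset.sum_range_zero] at hz
  have h1 := cf_one hγ
  have hc0 : cf γ 0 = 1 := rfl
  rw [hc0] at hz
  push_cast at hz
  linear_combination hz + 3 * y * h1

/-- Away from the constant term, the sums are `O(y)`. -/
lemma expBigO_Es_sub (hγ : 0 < γ) (hγ1 : γ ≤ 1 / 4) (j : ℕ) :
    ExpBigO (fun x => Es γ j x - 0 ^ j) (-3) := by
  obtain ⟨K, hK, hb⟩ := cf_bounded hγ hγ1
  have hs := (summable_Es_bound (2 * K) j (by norm_num : (0:ℝ) ≤ 1 / 2) (by norm_num))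
  have hs1 := (summable_nat_add_iff 1).2 hs
  refine ExpBigO.of_le (C := ∑' n : ℕ, ((n + 1 : ℕ):ℝ) ^ j * (2 * K) * (1 / 2) ^ (n + 1))
    fun x hx => ?_
  have h1 := (hasSum_nat_add_iff' 1).2 (hasSum_Es hγ hγ1 j x)
  simp only [Finset.sum_range_one, Nat.cast_zero, pow_zero, mul_one,
    show cf γ 0 = 1 from rfl] at h1
  rw [← h1.tsum_eq, ← tsum_mul_right, ← norm_eq_abs]
  refine tsum_of_norm_bounded (hs1.mul_right _).hasSum fun n => ?_
  have hy := yv_le_half hx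
  have hy0 := yv_pos x
  have hc : ‖cf γ (n + 1)‖ ≤ K := hb _
  rw [norm_mul, norm_mul, norm_of_nonneg (pow_nonneg (Nat.cast_nonneg _) j),
    norm_of_nonneg (pow_nonneg hy0.le _)]
  have hpow : yv x ^ (n + 1) ≤ 2 * (1 / 2) ^ (n + 1) * exp (-3 * x) := by
    calc yv x ^ (n + 1) = yv x ^ n * yv x := pow_succ _ _
      _ ≤ (1 / 2) ^ n * exp (-3 * x) := by
        gcongr
        exact yv_le_exp x
      _ = _ := by rw [pow_succ]; ring
  calc _ ≤ ((n + 1 : ℕ):ℝ) ^ j * K * (2 * (1 / 2) ^ (n + 1) * exp (-3 * x)) := by gcongr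
    _ = _ := by ring

end Series

section CoefficientBounds

variable {γ : ℝ}

lemma cf_two (hγ : 0 < γ) : (35 + 18 * γ + 3 * γ ^ 2) * cf γ 2
    = (-13 + 7 * γ / 3) * cf γ 1 + 40 := by
  have h := cf_rec hγ 0
  norm_num [show cf γ 0 = 1 from rfl] at h
  linear_combination h

lemma cf_three (hγ : 0 < γ) : (80 + 27 * γ + 3 * γ ^ 2) * cf γ 3
    = (50 + 122 * γ / 9) * cf γ 2 + 22 * cf γ 1 := by
  have h := cf_rec hγ 1
  norm_num at h
  linear_combination h

lemma cf_four (hγ : 0 < γ) : (143 + 36 * γ + 3 * γ ^ 2) * cf γ 4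
    = (149 + 71 * γ / 3) * cf γ 3 - 14 * cf γ 2 := by
  have h := cf_rec hγ 2
  norm_num at h
  linear_combination h

lemma cf_five (hγ : 0 < γ) : (224 + 45 * γ + 3 * γ ^ 2) * cf γ 5
    = (284 + 100 * γ / 3) * cf γ 4 - 68 * cf γ 3 := by
  have h := cf_rec hγ 3
  norm_num at h
  linear_combination h

lemma cf_six (hγ : 0 < γ) : (323 + 54 * γ + 3 * γ ^ 2) * cf γ 6
    = (455 + 385 * γ / 9) * cf γ 5 - 140 * cf γ 4 := by
  have h := cf_rec hγ 4
  norm_num at h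
  linear_combination h

lemma le_cf_one (hγ : 0 < γ) (hγ1 : γ ≤ 23 / 100) : -5 + 343 / 100 * γ ≤ cf γ 1 := by
  have hA : 0 < 8 + 9 * γ + 3 * γ ^ 2 := by positivity
  refine le_of_mul_le_mul_left ?_ hA
  rw [cf_one hγ]
  nlinarith [mul_nonneg hγ.le (sub_nonneg.2 hγ1),
    mul_nonneg hγ.le (mul_nonneg hγ.le (sub_nonneg.2 hγ1))]

lemma cf_one_le (hγ : 0 < γ) (hγ1 : γ ≤ 23 / 100) : cf γ 1 ≤ -42 / 10 := by
  have hA : 0 < 8 + 9 * γ + 3 * γ ^ 2 := by positivity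
  refine le_of_mul_le_mul_left ?_ hA
  rw [cf_one hγ]
  nlinarith [mul_nonneg hγ.le (sub_nonneg.2 hγ1)]

lemma le_cf_two (hγ : 0 < γ) (hγ1 : γ ≤ 23 / 100) : 289 / 100 - 235 / 100 * γ ≤ cf γ 2 := by
  have hA : 0 < (8 + 9 * γ + 3 * γ ^ 2) * (35 + 18 * γ + 3 * γ ^ 2) := by positivity
  refine le_of_mul_le_mul_left ?_ hA
  have h1 := cf_one hγ
  have h2 := cf_two hγ
  have e : (8 + 9 * γ + 3 * γ ^ 2) * (35 + 18 * γ + 3 * γ ^ 2) * cf γ 2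
      = (-13 + 7 * γ / 3) * (-40 * (3 + γ) / 3) + 40 * (8 + 9 * γ + 3 * γ ^ 2) := by
    linear_combination (8 + 9 * γ + 3 * γ ^ 2) * h2 + (-13 + 7 * γ / 3) * h1
  rw [e]
  obtain ⟨u, hu⟩ : ∃ u, γ = 23 / 100 - u := ⟨23 / 100 - γ, by ring⟩
  have hu0 : 0 ≤ u := by linarith
  have hu1 : u ≤ 23 / 100 := by linarith
  subst hu
  nlinarith [mul_nonneg (sq_nonneg u) (sub_nonneg.2 hu1), sq_nonneg u, pow_nonneg hu0 4,
    mul_nonneg (pow_nonneg hu0 4) (sub_nonneg.2 hu1)]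

lemma le_cf_three (hγ : 0 < γ) (hγ1 : γ ≤ 23 / 100) : 476 / 1000 - 445 / 1000 * γ ≤ cf γ 3 := by
  have hA : 0 < (8 + 9 * γ + 3 * γ ^ 2) * (35 + 18 * γ + 3 * γ ^ 2)
    * (80 + 27 * γ + 3 * γ ^ 2) := by positivity
  refine le_of_mul_le_mul_left ?_ hA
  have h1 := cf_one hγ
  have h2 := cf_two hγ
  have h3 := cf_three hγ
  have e : (8 + 9 * γ + 3 * γ ^ 2) * (35 + 18 * γ + 3 * γ ^ 2) * (80 + 27 * γ + 3 * γ ^ 2)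
      * cf γ 3 = (50 + 122 * γ / 9) * ((-13 + 7 * γ / 3) * (-40 * (3 + γ) / 3)
        + 40 * (8 + 9 * γ + 3 * γ ^ 2))
        + 22 * (35 + 18 * γ + 3 * γ ^ 2) * (-40 * (3 + γ) / 3) := by
    linear_combination (8 + 9 * γ + 3 * γ ^ 2) * (35 + 18 * γ + 3 * γ ^ 2) * h3
      + (50 + 122 * γ / 9) * ((8 + 9 * γ + 3 * γ ^ 2) * h2 + (-13 + 7 * γ / 3) * h1)
      + 22 * (35 + 18 * γ + 3 * γ ^ 2) * h1
  rw [e]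
  obtain ⟨u, hu⟩ : ∃ u, γ = 23 / 100 - u := ⟨23 / 100 - γ, by ring⟩
  have hu0 : 0 ≤ u := by linarith
  have hu1 : u ≤ 23 / 100 := by linarith
  subst hu
  nlinarith [mul_nonneg (sq_nonneg u) (sub_nonneg.2 hu1), sq_nonneg u, pow_nonneg hu0 4,
    mul_nonneg (pow_nonneg hu0 4) (sub_nonneg.2 hu1), pow_nonneg hu0 6,
    mul_nonneg (pow_nonneg hu0 6) (sub_nonneg.2 hu1), sq_nonneg (u - 1 / 200)]

lemma cf_two_le (hγ : 0 < γ) (hγ1 : γ ≤ 23 / 100) : cf γ 2 ≤ 3 := by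
  have hA : 0 < 35 + 18 * γ + 3 * γ ^ 2 := by positivity
  refine le_of_mul_le_mul_left ?_ hA
  have h1 := le_cf_one hγ hγ1
  have h2 := cf_one_le hγ hγ1
  rw [cf_two hγ]
  nlinarith [sq_nonneg γ]

lemma cf_two_cf_one (hγ : 0 < γ) :
    (35 + 18 * γ + 3 * γ ^ 2) * (3 + γ) * cf γ 2
      = -(63 + 33 * γ + 20 * γ ^ 2 / 3) * cf γ 1 := by
  linear_combination (3 + γ) * cf_two hγ + 3 * cf_one hγ

lemma cf_three_bounds (hγ : 0 < γ) (hγ1 : γ ≤ 23 / 100) :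
    (1663 / 10000 - 32 / 1000 * γ) * cf γ 2 ≤ cf γ 3 ∧ cf γ 3 ≤ 17 / 100 * cf γ 2 := by
  have h2 : 0 < cf γ 2 := by have := le_cf_two hγ hγ1; linarith
  have hA : 0 < (63 + 33 * γ + 20 * γ ^ 2 / 3) * (80 + 27 * γ + 3 * γ ^ 2) := by positivity
  have e : (63 + 33 * γ + 20 * γ ^ 2 / 3) * (80 + 27 * γ + 3 * γ ^ 2) * cf γ 3
      = ((63 + 33 * γ + 20 * γ ^ 2 / 3) * (50 + 122 * γ / 9)
        - 22 * ((35 + 18 * γ + 3 * γ ^ 2) * (3 + γ))) * cf γ 2 := by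
    linear_combination (63 + 33 * γ + 20 * γ ^ 2 / 3) * cf_three hγ + 22 * cf_two_cf_one hγ
  constructor
  · refine le_of_mul_le_mul_left ?_ hA
    rw [← mul_assoc, e]
    refine mul_le_mul_of_nonneg_right ?_ h2.le
    nlinarith [sq_nonneg (γ - 128 / 1000), pow_pos hγ 3, pow_pos hγ 4, pow_pos hγ 5]
  · refine le_of_mul_le_mul_left ?_ hA
    rw [← mul_assoc, e]
    refine mul_le_mul_of_nonneg_right ?_ h2.le
    nlinarith [pow_pos hγ 3, pow_pos hγ 4, pow_pos hγ 2]

/-- Sign and size of the first coefficients. -/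
lemma cf_chain (hγ : 0 < γ) (hγ1 : γ ≤ 23 / 100) :
    0 < cf γ 3 ∧ 0 < cf γ 5 ∧ cf γ 5 ≤ cf γ 4 ∧ 2 * cf γ 4 ≤ cf γ 3 ∧
      2 / 3 * cf γ 5 ≤ cf γ 6 ∧ cf γ 6 ≤ cf γ 5 := by
  have h2 : 0 < cf γ 2 := by have := le_cf_two hγ hγ1; linarith
  have hg2 : 0 ≤ γ * (23 / 100 - γ) := mul_nonneg hγ.le (by linarith)
  have hg3 : 0 ≤ γ * (γ * (23 / 100 - γ)) := mul_nonneg hγ.le hg2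
  have hg4 : 0 ≤ γ * (γ * (γ * (23 / 100 - γ))) := mul_nonneg hγ.le hg3
  obtain ⟨h3l, h3u⟩ := cf_three_bounds hγ hγ1
  have h3 : 0 < cf γ 3 := lt_of_lt_of_le (mul_pos (by linarith) h2) h3l
  have e4 := cf_four hγ
  have e5 := cf_five hγ
  have e6 := cf_six hγ
  have hA4 : 0 < 143 + 36 * γ + 3 * γ ^ 2 := by positivity
  have hA5 : 0 < 224 + 45 * γ + 3 * γ ^ 2 := by positivity
  have hA6 : 0 < 323 + 54 * γ + 3 * γ ^ 2 := by positivity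
  have h4l : (453 / 1000 - 66 / 1000 * γ) * cf γ 3 ≤ cf γ 4 := by
    have hl : 0 < 1663 / 10000 - 32 / 1000 * γ := by linarith
    refine le_of_mul_le_mul_left ?_ (mul_pos hl hA4)
    have hp : 0 ≤ (1663 / 10000 - 32 / 1000 * γ) * (149 + 71 * γ / 3) - 14
        - (1663 / 10000 - 32 / 1000 * γ) * (143 + 36 * γ + 3 * γ ^ 2)
          * (453 / 1000 - 66 / 1000 * γ) := by nlinarith
    have := mul_nonneg hp h3.le
    linear_combination this + 14 * h3l - (1663 / 10000 - 32 / 1000 * γ) * e4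
  have h4 : 0 < cf γ 4 := lt_of_lt_of_le (mul_pos (by linarith) h3) h4l
  have h5l : (597 / 1000 - 69 / 1000 * γ) * cf γ 4 ≤ cf γ 5 := by
    have hl : 0 < 453 / 1000 - 66 / 1000 * γ := by linarith
    refine le_of_mul_le_mul_left ?_ (mul_pos hl hA5)
    have hp : 0 ≤ (453 / 1000 - 66 / 1000 * γ) * (284 + 100 * γ / 3) - 68
        - (453 / 1000 - 66 / 1000 * γ) * (224 + 45 * γ + 3 * γ ^ 2)
          * (597 / 1000 - 69 / 1000 * γ) := by nlinarith
    have := mul_nonneg hp h4.le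
    linear_combination this + 68 * h4l - (453 / 1000 - 66 / 1000 * γ) * e5
  have h5 : 0 < cf γ 5 := lt_of_lt_of_le (mul_pos (by linarith) h4) h5l
  have h6l : 2 / 3 * cf γ 5 ≤ cf γ 6 := by
    have hl : 0 < 597 / 1000 - 69 / 1000 * γ := by linarith
    refine le_of_mul_le_mul_left ?_ (mul_pos hl hA6)
    have hp : 0 ≤ (597 / 1000 - 69 / 1000 * γ) * (455 + 385 * γ / 9) - 140
        - (597 / 1000 - 69 / 1000 * γ) * (323 + 54 * γ + 3 * γ ^ 2) * (2 / 3) := by nlinarith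
    have := mul_nonneg hp h5.le
    linear_combination this + 140 * h5l - (597 / 1000 - 69 / 1000 * γ) * e6
  have h4u : 2 * cf γ 4 ≤ cf γ 3 := by
    refine le_of_mul_le_mul_left ?_ hA4
    have : 0 ≤ (14 / 17 * 100 - 155 - 34 * γ / 3 + 3 * γ ^ 2 + 155 / 2) * cf γ 3 :=
      mul_nonneg (by nlinarith) h3.le
    nlinarith [mul_pos hγ h3, mul_pos (pow_pos hγ 2) h3]
  have h5u : cf γ 5 ≤ cf γ 4 := by
    refine le_of_mul_le_mul_left ?_ hA5
    nlinarith [mul_pos hγ h4, mul_pos (pow_pos hγ 2) h4]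
  have h6u : cf γ 6 ≤ cf γ 5 := by
    refine le_of_mul_le_mul_left ?_ hA6
    nlinarith [mul_pos hγ h5, mul_pos (pow_pos hγ 2) h5]
  exact ⟨h3, h5, h5u, h4u, h6l, h6u⟩

/-- The later coefficients are dominated by the fifth one. -/
lemma abs_cf_le (hγ : 0 < γ) (hγ1 : γ ≤ 23 / 100) (n : ℕ) : |cf γ (n + 5)| ≤ cf γ 5 := by
  obtain ⟨_, h5, -, -, h6, h6'⟩ := cf_chain hγ hγ1
  exact (cf_box hγ (by linarith) (abs_of_pos h5).le
    (abs_le.2 ⟨by linarith, by linarith⟩) n).1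

end CoefficientBounds

section SeriesBounds

variable {γ : ℝ}

lemma abs_Es_zero_sub_le (hγ : 0 < γ) (hγ1 : γ ≤ 23 / 100) {x : ℝ} (hx : 0 ≤ x) :
    |Es γ 0 x - (1 + cf γ 1 * yv x + cf γ 2 * yv x ^ 2 + cf γ 3 * yv x ^ 3 + cf γ 4 * yv x ^ 4
      + cf γ 5 * yv x ^ 5)| ≤ cf γ 5 * yv x ^ 5 := by
  have hy := yv_le_half hx
  have hy0 := yv_pos x
  have h5 := (cf_chain hγ hγ1).2.1
  have h := (hasSum_nat_add_iff' 6).2 (hasSum_Es hγ (by linarith) 0 x)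
  simp only [Finset.sum_range_succ, Finset.sum_range_zero, show cf γ 0 = 1 from rfl, pow_zero,
    one_mul, zero_add, pow_one, mul_one] at h
  have hg := (hasSum_geometric_of_lt_one hy0.le (yv_lt_one x)).mul_left (cf γ 5 * yv x ^ 6)
  rw [← h.tsum_eq, ← norm_eq_abs]
  refine (tsum_of_norm_bounded hg fun n => ?_).trans ?_
  · have : ‖cf γ (n + 6)‖ ≤ cf γ 5 := abs_cf_le hγ hγ1 (n + 1)
    rw [norm_mul, norm_of_nonneg (pow_nonneg hy0.le _)]
    calc _ ≤ cf γ 5 * yv x ^ (n + 6) := by gcongr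
      _ = _ := by ring
  · have : yv x * (1 - yv x)⁻¹ ≤ 1 := by
      rw [← div_eq_mul_inv, div_le_one (by linarith)]; linarith
    calc cf γ 5 * yv x ^ 6 * (1 - yv x)⁻¹ = cf γ 5 * yv x ^ 5 * (yv x * (1 - yv x)⁻¹) := by ring
      _ ≤ cf γ 5 * yv x ^ 5 * 1 := by gcongr
      _ = _ := mul_one _

lemma le_Es_zero (hγ : 0 < γ) (hγ1 : γ ≤ 23 / 100) {x : ℝ} (hx : 0 ≤ x) :
    1 + cf γ 1 * yv x + cf γ 2 * yv x ^ 2 + cf γ 3 * yv x ^ 3 ≤ Es γ 0 x := by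
  obtain ⟨h3, h5, h54, -⟩ := cf_chain hγ hγ1
  have h := (abs_le.1 (abs_Es_zero_sub_le hγ hγ1 hx)).1
  have := mul_pos (h5.trans_le h54) (pow_pos (yv_pos x) 4)
  linarith

lemma Es_zero_zero_le (hγ : 0 < γ) (hγ1 : γ ≤ 23 / 100) :
    Es γ 0 0 ≤ 1 + cf γ 1 / 2 + cf γ 2 / 4 + 3 * cf γ 3 / 16 := by
  obtain ⟨h3, h5, h54, h43, -⟩ := cf_chain hγ hγ1
  have h := (abs_le.1 (abs_Es_zero_sub_le hγ hγ1 le_rfl)).2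
  rw [yv_zero] at h
  norm_num at h
  linarith

lemma le_Es_one_zero (hγ : 0 < γ) (hγ1 : γ ≤ 23 / 100) :
    cf γ 1 / 2 + cf γ 2 / 2 + 3 * cf γ 3 / 8 ≤ Es γ 1 0 := by
  obtain ⟨h3, h5, h54, -⟩ := cf_chain hγ hγ1
  have h := (hasSum_nat_add_iff' 6).2 (hasSum_Es hγ (by linarith) 1 0)
  simp only [Finset.sum_range_succ, Finset.sum_range_zero, yv_zero] at h
  norm_num at h
  have hr : ‖(1 / 2 : ℝ)‖ < 1 := by norm_num
  have hg := ((hasSum_coe_mul_geometric_of_norm_lt_one hr).add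
    ((hasSum_geometric_of_norm_lt_one hr).mul_left 6)).mul_left (cf γ 5 / 64)
  have h1 := tsum_of_norm_bounded (f := fun n : ℕ => ((n:ℝ) + 6) * cf γ (n + 6) * (1 / 2) ^ (n + 6))
    hg fun n => ?_
  · rw [h.tsum_eq, norm_eq_abs] at h1
    have := (abs_le.1 h1).1
    norm_num at this
    linarith
  · have : ‖cf γ (n + 6)‖ ≤ cf γ 5 := abs_cf_le hγ hγ1 (n + 1)
    rw [norm_mul, norm_mul, norm_of_nonneg (by positivity : (0:ℝ) ≤ n + 6),
      norm_of_nonneg (by positivity : (0:ℝ) ≤ (1 / 2) ^ (n + 6))]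
    calc _ ≤ ((n:ℝ) + 6) * cf γ 5 * (1 / 2) ^ (n + 6) := by gcongr
      _ = _ := by ring

end SeriesBounds

/-! ### The dual solution -/

/-- The solution of `(L T)' = -(γ - γ³) T` asymptotic to `e^{-γx}` at `+∞`. -/
noncomputable def Td (γ x : ℝ) : ℝ := exp (-γ * x) * Es γ 0 x

/-- The derivative of `Td`. -/
noncomputable def Td' (γ x : ℝ) : ℝ :=
  exp (-γ * x) * (-γ * Es γ 0 x - 3 * (1 - yv x) * Es γ 1 x)

/-- The second derivative of `Td`. -/
noncomputable def Td'' (γ x : ℝ) : ℝ :=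
  exp (-γ * x) * (γ ^ 2 * Es γ 0 x + (6 * γ * (1 - yv x) - 9 * yv x * (1 - yv x)) * Es γ 1 x
    + 9 * (1 - yv x) ^ 2 * Es γ 2 x)

/-- `L` applied to `Td`. -/
noncomputable def LTd (γ x : ℝ) : ℝ :=
  -Td'' γ x + Td γ x - 40 * yv x * (1 - yv x) * Td γ x

section Dual

variable {γ : ℝ}

lemma hasDerivAt_exp_mul_left (a x : ℝ) :
    HasDerivAt (fun x => exp (a * x)) (a * exp (a * x)) x := by
  refine (((hasDerivAt_id x).const_mul a).exp).congr_deriv ?_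
  simp only [id]; ring

lemma hasDerivAt_Td (hγ : 0 < γ) (hγ1 : γ ≤ 1 / 4) (x : ℝ) :
    HasDerivAt (Td γ) (Td' γ x) x := by
  refine ((hasDerivAt_exp_mul_left (-γ) x).mul (hasDerivAt_Es hγ hγ1 0 x)).congr_deriv ?_
  simp only [Td']; ring

lemma hasDerivAt_Td' (hγ : 0 < γ) (hγ1 : γ ≤ 1 / 4) (x : ℝ) :
    HasDerivAt (Td' γ) (Td'' γ x) x := by
  have h := (hasDerivAt_exp_mul_left (-γ) x).mul (((hasDerivAt_Es hγ hγ1 0 x).const_mul (-γ)).sub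
    ((((hasDerivAt_yv x).const_sub 1).const_mul 3).mul (hasDerivAt_Es hγ hγ1 1 x)))
  refine h.congr_deriv ?_
  simp only [Td'', Pi.sub_apply, Pi.mul_apply]; ring

lemma hasDerivAt_LTd (hγ : 0 < γ) (hγ1 : γ ≤ 1 / 4) (x : ℝ) :
    HasDerivAt (LTd γ) (-(γ - γ ^ 3) * Td γ x) x := by
  have hy := hasDerivAt_yv x
  have h1y := hy.const_sub 1
  have hE := fun j => hasDerivAt_Es hγ hγ1 j x
  have h2 := (hasDerivAt_exp_mul_left (-γ) x).mul ((((hE 0).const_mul (γ ^ 2)).add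
    (((h1y.const_mul (6 * γ)).sub ((hy.const_mul 9).mul h1y)).mul (hE 1))).add
    (((h1y.pow 2).const_mul 9).mul (hE 2)))
  have hT := hasDerivAt_Td hγ hγ1 x
  have h := (h2.neg.add hT).sub (((hy.const_mul 40).mul h1y).mul hT)
  refine h.congr_deriv ?_
  simp only [Pi.sub_apply, Pi.mul_apply, Pi.add_apply, Pi.pow_apply, Td, Td']
  have hr := Es_relation hγ hγ1 x
  push_cast
  linear_combination exp (-γ * x) * (1 - yv x) * hr

lemma expBigO_one_sub_yv : ExpBigO (fun x => 1 - yv x) 0 :=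
  ExpBigO.of_le (C := 1) fun x _ => by
    rw [abs_of_pos (by linarith [yv_lt_one x])]; simp [(yv_pos x).le]

lemma expBigO_Td_sub (hγ : 0 < γ) (hγ1 : γ ≤ 1 / 4) :
    ExpBigO (fun x => Td γ x - exp (-γ * x)) (-γ - 3) := by
  have h := (expBigO_exp (-γ)).mul (expBigO_Es_sub hγ hγ1 0)
  rw [← sub_eq_add_neg] at h
  refine h.congr_left fun x => ?_
  simp only [Td, pow_zero]; ring

lemma expBigO_Es_succ (hγ : 0 < γ) (hγ1 : γ ≤ 1 / 4) (j : ℕ) : ExpBigO (Es γ (j + 1)) (-3) :=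
  (expBigO_Es_sub hγ hγ1 (j + 1)).congr_left fun x => by simp

lemma expBigO_Td'_add (hγ : 0 < γ) (hγ1 : γ ≤ 1 / 4) :
    ExpBigO (fun x => Td' γ x + γ * exp (-γ * x)) (-γ - 3) := by
  have h1 := (expBigO_one_sub_yv.mul (expBigO_Es_succ hγ hγ1 0)).const_mul 3
  simp only [zero_add] at h1
  have h := (expBigO_exp (-γ)).mul (((expBigO_Es_sub hγ hγ1 0).const_mul (-γ)).sub h1)
  rw [← sub_eq_add_neg] at h
  refine h.congr_left fun x => ?_
  simp only [Td', pow_zero]; ring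

lemma expBigO_LTd_sub (hγ : 0 < γ) (hγ1 : γ ≤ 1 / 4) :
    ExpBigO (fun x => LTd γ x - (1 - γ ^ 2) * exp (-γ * x)) (-γ - 3) := by
  have e0 := expBigO_Es_sub hγ hγ1 0
  have e1 := expBigO_Es_succ hγ hγ1 0
  have e2 := expBigO_Es_succ hγ hγ1 1
  have hc := expBigO_one_sub_yv
  have h0 : ExpBigO (fun x => Es γ 0 x) 0 := by
    have := (e0.mono (by norm_num : (-3:ℝ) ≤ 0)).add (expBigO_const 1)
    refine this.congr_left fun x => by simp
  have a1 := (hc.mul e1).const_mul (6 * γ)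
  have a2 := ((expBigO_yv.mono (by norm_num : (-3:ℝ) ≤ 0)).mul (hc.mul e1)).const_mul 9
  have a3 := (hc.mul (hc.mul e2)).const_mul 9
  have a4 := (expBigO_yv.mul (hc.mul h0)).const_mul 40
  simp only [zero_add, add_zero] at a1 a2 a3 a4
  have h := (expBigO_exp (-γ)).mul
    (((((e0.const_mul (1 - γ ^ 2)).sub a1).add a2).sub a3).sub a4)
  rw [← sub_eq_add_neg] at h
  refine h.congr_left fun x => ?_
  simp only [LTd, Td, Td'', pow_zero]; ring

lemma Td_zero : Td γ 0 = Es γ 0 0 := by simp [Td]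

lemma Td'_zero : Td' γ 0 = -γ * Es γ 0 0 - 3 / 2 * Es γ 1 0 := by
  simp only [Td', mul_zero, exp_zero, yv_zero]; ring

/-- Lower bound of the value at `0` by comparison with a quadratic in `y`. -/
lemma le_LTd_zero (hγ : 0 < γ) (hγ1 : γ ≤ 23 / 100) {p₀ p₁ p₂ : ℝ} (h0 : (1 + γ) * p₀ = 1)
    (h1 : (4 + γ) * p₁ = 2 * p₀ + cf γ 1) (h2 : (3 + γ) * p₂ = cf γ 2 + 5 * p₁) (hp2 : p₂ ≤ 0) :
    (γ - γ ^ 3) * (p₀ + p₁ / 2 + p₂ / 4) ≤ LTd γ 0 + 3 / 2 * Td γ 0 := by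
  have hγ2 : γ ≤ 1 / 4 := by linarith
  have hl : 0 ≤ γ - γ ^ 3 := by nlinarith [sq_nonneg γ]
  have hy := fun x => hasDerivAt_yv x
  have hd : ∀ x, HasDerivAt (fun x => Q x * (LTd γ x - (1 - 2 * yv x) * Td' γ x
        - (1 - 10 * yv x * (1 - yv x)) * Td γ x)
        - (γ - γ ^ 3) * (Q x * (exp (-γ * x) * (p₀ + p₁ * yv x + p₂ * yv x ^ 2))))
      (-((γ - γ ^ 3) * Q x * exp (-γ * x) * (Es γ 0 x - (1 + cf γ 1 * yv x + cf γ 2 * yv x ^ 2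
        + 4 * p₂ * yv x ^ 2 * (1 - 2 * yv x))))) x := by
    intro x
    have hT := hasDerivAt_Td hγ hγ2 x
    have hT' := hasDerivAt_Td' hγ hγ2 x
    have hL := hasDerivAt_LTd hγ hγ2 x
    have hA := (hasDerivAt_Q x).mul ((hL.sub ((((hy x).const_mul 2).const_sub 1).mul hT')).sub
      (((((hy x).const_mul 10).mul ((hy x).const_sub 1)).const_sub 1).mul hT))
    have hB := ((hasDerivAt_Q x).mul ((hasDerivAt_exp_mul_left (-γ) x).mul
      ((((hy x).const_mul p₁).const_add p₀).add (((hy x).pow 2).const_mul p₂)))).const_mul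
      (γ - γ ^ 3)
    refine (hA.sub hB).congr_deriv ?_
    simp only [Pi.sub_apply, Pi.mul_apply, Pi.add_apply, Pi.pow_apply, LTd, Td]
    push_cast
    linear_combination (γ - γ ^ 3) * Q x * exp (-γ * x) * (h0 + yv x * h1 + yv x ^ 2 * h2)
  have hQ := expBigO_Q
  have he := expBigO_exp (-γ)
  have hb : ∀ {f : ℝ → ℝ} {k : ℝ}, ExpBigO (fun x => f x - k * exp (-γ * x)) (-γ - 3) →
      ExpBigO f 0 := by
    intro f k hf
    have := (hf.mono (by linarith : -γ - 3 ≤ 0)).add ((he.const_mul k).mono (by linarith))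
    exact this.congr_left fun x => by ring
  have bT : ExpBigO (Td γ) 0 := hb (k := 1) ((expBigO_Td_sub hγ hγ2).congr_left fun x => by ring)
  have bT' : ExpBigO (Td' γ) 0 := hb (k := -γ)
    ((expBigO_Td'_add hγ hγ2).congr_left fun x => by ring)
  have bL : ExpBigO (LTd γ) 0 := hb (expBigO_LTd_sub hγ hγ2)
  have by0 : ExpBigO yv 0 := expBigO_yv.mono (by norm_num)
  have hlim : Tendsto (fun x => Q x * (LTd γ x - (1 - 2 * yv x) * Td' γ x
        - (1 - 10 * yv x * (1 - yv x)) * Td γ x)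
        - (γ - γ ^ 3) * (Q x * (exp (-γ * x) * (p₀ + p₁ * yv x + p₂ * yv x ^ 2)))) atTop
      (nhds 0) := by
    have c1 := ((expBigO_const 1).sub (by0.const_mul 2)).mul bT'
    have c2 := by0.mul expBigO_one_sub_yv
    rw [add_zero] at c1 c2
    have c3 := ((expBigO_const 1).sub (c2.const_mul 10)).mul bT
    have c4 := by0.mul by0
    rw [add_zero] at c3 c4
    have c5 := (he.mono (by linarith : -γ ≤ 0)).mul
      (((expBigO_const p₀).add (by0.const_mul p₁)).add (c4.const_mul p₂))
    rw [add_zero] at c5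
    have c6 := (hQ.mul ((bL.sub c1).sub c3)).sub ((hQ.mul c5).const_mul (γ - γ ^ 3))
    refine (c6.tendsto_zero (by norm_num)).congr fun x => ?_
    ring
  have h := nonneg_of_deriv_nonpos (X := 0) hd (fun x hx => ?_) hlim le_rfl
  · simp only [yv_zero, mul_zero, exp_zero] at h
    have hq := Q_pos 0
    have h' : 0 ≤ Q 0 * (LTd γ 0 + 3 / 2 * Td γ 0 - (γ - γ ^ 3) * (p₀ + p₁ / 2 + p₂ / 4)) := by
      linarith
    linarith [nonneg_of_mul_nonneg_right h' hq]
  · have hE := le_Es_zero hγ hγ1 hx.le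
    have hy0 := yv_pos x
    have hy1 := yv_le_half hx.le
    have h3 := mul_pos (cf_chain hγ hγ1).1 (pow_pos hy0 3)
    have h4 : 0 ≤ -p₂ * (yv x ^ 2 * (1 - 2 * yv x)) :=
      mul_nonneg (by linarith) (mul_nonneg (sq_nonneg _) (by linarith))
    have := Q_pos x
    rw [neg_nonpos]
    refine mul_nonneg (by positivity) ?_
    linarith

end Dual

/-! ### Comparison for the equation at `+∞` -/

/-- Sturm-type comparison: if the weighted Wronskian increases to `0`, the quotient decreases. -/
lemma div_le_div_of_wronskian {φ φ' ω ω' W W' ρ : ℝ → ℝ} {X : ℝ}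
    (hφ : ∀ x, HasDerivAt φ (φ' x) x) (hω : ∀ x, HasDerivAt ω (ω' x) x)
    (hW : ∀ x, HasDerivAt W (W' x) x) (hWρ : ∀ x, W x = ρ x * (φ' x * ω x - φ x * ω' x))
    (hρ : ∀ x, 0 < ρ x) (hωpos : ∀ x, X ≤ x → 0 < ω x) (hW' : ∀ x, X < x → 0 ≤ W' x)
    (hlim : Tendsto W atTop (nhds 0)) {a b : ℝ} (ha : X ≤ a) (hab : a ≤ b) :
    φ b / ω b ≤ φ a / ω a := by
  have hneg : ∀ x, X ≤ x → φ' x * ω x - φ x * ω' x ≤ 0 := by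
    intro x hx
    have h := nonneg_of_deriv_nonpos (φ := fun x => -W x) (X := X) (fun x => (hW x).neg)
      (fun x hx => neg_nonpos.2 (hW' x hx)) (by simpa using hlim.neg) hx
    rw [hWρ] at h
    by_contra hc
    push Not at hc
    have := mul_pos (hρ x) hc
    linarith
  have hd : ∀ x, X ≤ x → HasDerivAt (fun x => φ x / ω x)
      ((φ' x * ω x - φ x * ω' x) / ω x ^ 2) x := fun x hx =>
    (hφ x).div (hω x) (hωpos x hx).ne'
  have hanti : AntitoneOn (fun x => φ x / ω x) (Set.Ici X) := by
    refine antitoneOn_of_deriv_nonpos (convex_Ici X)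
      (fun z hz => (hd z hz).continuousAt.continuousWithinAt)
      (fun z hz => (hd z (interior_subset hz)).differentiableAt.differentiableWithinAt)
      fun z hz => ?_
    have hz' : X ≤ z := interior_subset hz
    rw [(hd z hz').deriv]
    exact div_nonpos_of_nonpos_of_nonneg (hneg z hz') (sq_nonneg _)
  exact hanti ha (ha.trans hab : X ≤ b) hab

/-- `tanh(3x/2) / Q`, a solution of the homogeneous reduced equation. -/
noncomputable def tauQ (x : ℝ) : ℝ := (1 - 2 * yv x) / Q x

lemma hasDerivAt_tauQ (x : ℝ) :
    HasDerivAt tauQ ((1 + 2 * yv x * (1 - yv x)) / Q x) x := by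
  have hQ := (Q_pos x).ne'
  refine ((((hasDerivAt_yv x).const_mul 2).const_sub 1).div (hasDerivAt_Q x) hQ).congr_deriv ?_
  field_simp
  ring

lemma yv_lt_half {x : ℝ} (hx : 0 < x) : yv x < 1 / 2 := by
  unfold yv
  have : 1 < exp (3 * x) := one_lt_exp_iff.2 (by linarith)
  exact one_div_lt_one_div_of_lt (by norm_num) (by linarith)

lemma tauQ_pos {x : ℝ} (hx : 0 < x) : 0 < tauQ x :=
  div_pos (by linarith [yv_lt_half hx]) (Q_pos x)

lemma tendsto_yv : Tendsto yv atTop (nhds 0) := expBigO_yv.tendsto_zero (by norm_num)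

lemma expBigO_tauQ_inv : ExpBigO (fun x => (tauQ x)⁻¹) (-1) := by
  have h1 : ExpBigO (fun x => (1 - 2 * yv x)⁻¹) 0 := by
    have ht : Tendsto (fun x => (1 - 2 * yv x)⁻¹) atTop (nhds (1 - 2 * 0)⁻¹) :=
      ((tendsto_yv.const_mul 2).const_sub 1).inv₀ (by norm_num)
    have := ExpBigO.of_tendsto (f := fun x => (1 - 2 * yv x)⁻¹) (a := 0) (by simpa using ht)
    simpa using this
  have h := expBigO_Q.mul h1
  rw [add_zero] at h
  refine h.congr_left fun x => ?_
  rw [tauQ, inv_div, div_eq_mul_inv]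

lemma ExpBigO.tendsto_div_tauQ {f : ℝ → ℝ} {a : ℝ} (hf : ExpBigO f a) (ha : a < 1) :
    Tendsto (fun x => f x / tauQ x) atTop (nhds 0) := by
  have := hf.mul expBigO_tauQ_inv
  exact this.tendsto_zero (by linarith)

section Right

variable {h g n : ℝ → ℝ} {δ l b : ℝ}

/-- Perturbed form of the sign of `(h e^{-δx})'`. -/
lemma deriv_sign_perturbed (hδ : 0 < δ) (hδ1 : δ ≤ 1 / 5) (hl : l = δ * (1 - δ) * (2 - δ))
    (hh : ∀ x, HasDerivAt h (g x) x) (hg : ∀ x, HasDerivAt g (n x) x)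
    (hn : ∀ x, HasDerivAt n
      (3 * (1 - 2 * yv x) * n x - (2 + 10 * yv x * (1 - yv x)) * g x + l * h x) x)
    (hb : Tendsto (fun x => h x * exp (-δ * x)) atTop (nhds b))
    (hf : ExpBigO (fun x => g x - δ * h x) (-2)) (hf' : ExpBigO (fun x => n x - δ * g x) (-2))
    {ε : ℝ} (hε : 0 < ε) (hεb : ε < b) {x : ℝ} (hx : 0 < x) :
    0 < -(g x - δ * h x) * exp (-δ * x) + ε * exp (-1 * x) := by
  set F : ℝ → ℝ := fun x => -(g x - δ * h x) * exp (-δ * x) + ε * exp (-1 * x) with hF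
  have hEδ : ExpBigO (fun x => exp (-δ * x)) 0 := (expBigO_exp (-δ)).mono (by linarith)
  have hFd : ∀ x, HasDerivAt F
      (-(n x - δ * g x - δ * (g x - δ * h x)) * exp (-δ * x) - ε * exp (-1 * x)) x := by
    intro x
    refine (((((hg x).sub ((hh x).const_mul δ)).neg).mul (hasDerivAt_exp_mul_left (-δ) x)).add
      ((hasDerivAt_exp_mul_left (-1) x).const_mul ε)).congr_deriv ?_
    simp only [Pi.neg_apply, Pi.sub_apply]; ring
  have hFcont : Continuous F := continuous_iff_continuousAt.2 fun x => (hFd x).continuousAt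
  have hFev : ∀ᶠ x in atTop, 0 < F x := by
    have h1 := ((hf.mul hEδ).mul (expBigO_exp 1)).tendsto_zero (by norm_num)
    have h2 := h1.eventually_lt_const hε
    filter_upwards [h2] with x hx
    have e : exp (1 * x) * exp (-1 * x) = 1 := by rw [← exp_add]; simp
    have hp := exp_pos (-1 * x)
    have : (g x - δ * h x) * exp (-δ * x) * exp (1 * x) * exp (-1 * x) < ε * exp (-1 * x) :=
      mul_lt_mul_of_pos_right hx hp
    rw [mul_assoc ((g x - δ * h x) * exp (-δ * x)), e] at this
    simp only [hF]; linarith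
  by_contra hbad
  obtain ⟨X, hX⟩ := eventually_atTop.1 hFev
  set S : Set ℝ := {z | x ≤ z ∧ F z ≤ 0} with hS
  have hSx : x ∈ S := ⟨le_rfl, not_lt.1 hbad⟩
  have hSbdd : BddAbove S := ⟨X, fun z hz => by
    by_contra hc
    exact absurd hz.2 (not_le.2 (hX z (not_le.1 hc).le))⟩
  have hSclosed : IsClosed S :=
    (isClosed_le continuous_const continuous_id).inter (isClosed_le hFcont continuous_const)
  obtain ⟨hxs, hFs⟩ := hSclosed.csSup_mem ⟨x, hSx⟩ hSbdd
  set z₀ := sSup S with hz₀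
  have hz0 : 0 < z₀ := hx.trans_le hxs
  have hpos : ∀ z, z₀ < z → 0 < F z := fun z hz => by
    by_contra hc
    exact absurd (le_csSup hSbdd ⟨hxs.trans hz.le, not_lt.1 hc⟩) (not_le.2 hz)
  have hepos : ∀ z, z₀ < z → 0 < h z := by
    intro z hz
    have h1 := nonneg_of_deriv_nonpos (X := z₀)
      (φ := fun x => h x * exp (-δ * x) + ε * exp (-1 * x) - b)
      (fun x => (((hh x).mul (hasDerivAt_exp_mul_left (-δ) x)).add
        ((hasDerivAt_exp_mul_left (-1) x).const_mul ε)).sub_const b)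
      (fun x hx => by
        have := hpos x hx
        simp only [hF] at this
        linarith) (by
        have := (hb.add (((expBigO_exp (-1)).const_mul ε).tendsto_zero (by norm_num))).sub_const b
        simpa using this) hz.le
    have h2 : exp (-1 * z) ≤ 1 := exp_le_one_iff.2 (by linarith)
    have h3 : 0 < h z * exp (-δ * z) := by nlinarith
    exact pos_of_mul_pos_left h3 (exp_pos _).le
  have hlim : Tendsto (fun x => exp (δ * x) * Q x ^ 2 *
      ((-(n x - δ * g x - δ * (g x - δ * h x)) * exp (-δ * x) - ε * exp (-1 * x)) * (1 - 2 * yv x)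
        - F x * (1 + 2 * yv x * (1 - yv x) - 2 * δ * (1 - 2 * yv x)))) atTop (nhds 0) := by
    have by0 : ExpBigO yv 0 := expBigO_yv.mono (by norm_num)
    have c1 := ((hf'.sub (hf.const_mul δ)).mul hEδ).const_mul (-1)
    rw [add_zero] at c1
    have c1' := (c1.mono (by norm_num : (-2:ℝ) ≤ -1)).sub ((expBigO_exp (-1)).const_mul ε)
    have ct := (expBigO_const 1).sub (by0.const_mul 2)
    have c2 := c1'.mul ct
    have c3 := (hf.mul hEδ).const_mul (-1)
    rw [add_zero] at c2 c3
    have c4 := (c3.mono (by norm_num : (-2:ℝ) ≤ -1)).add ((expBigO_exp (-1)).const_mul ε)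
    have c5 := by0.mul expBigO_one_sub_yv
    rw [add_zero] at c5
    have c6 := c4.mul (((expBigO_const 1).add (c5.const_mul 2)).sub (ct.const_mul (2 * δ)))
    rw [add_zero] at c6
    have c7 := ((expBigO_exp δ).mul (expBigO_Q.mul expBigO_Q)).mul (c2.sub c6)
    refine (c7.tendsto_zero (by linarith)).congr fun x => ?_
    simp only [hF]; ring
  have hω : ∀ x, HasDerivAt (fun x => exp (-2 * δ * x) * tauQ x)
      (exp (-2 * δ * x) * ((1 + 2 * yv x * (1 - yv x) - 2 * δ * (1 - 2 * yv x)) / Q x)) x := by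
    intro x
    refine ((hasDerivAt_exp_mul_left (-2 * δ) x).mul (hasDerivAt_tauQ x)).congr_deriv ?_
    rw [tauQ]; ring
  have hcomp := div_le_div_of_wronskian (X := z₀) (a := z₀) (b := z₀ + 1)
    (ρ := fun x => exp (3 * δ * x) * Q x ^ 3) hFd hω
    (W := fun x => exp (δ * x) * Q x ^ 2 *
      ((-(n x - δ * g x - δ * (g x - δ * h x)) * exp (-δ * x) - ε * exp (-1 * x)) * (1 - 2 * yv x)
        - F x * (1 + 2 * yv x * (1 - yv x) - 2 * δ * (1 - 2 * yv x))))
    (W' := fun x => exp (δ * x) * Q x ^ 2 * ((1 - 2 * yv x)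
      * (δ * (6 * δ * yv x + 10 * yv x * (1 - yv x)) * h x * exp (-δ * x)
        + ε * exp (-1 * x) * (3 + 3 * (1 - 2 * yv x) - 3 * δ + 3 * δ ^ 2 - 6 * (1 - 2 * yv x) * δ
          + 10 * yv x * (1 - yv x)))
      + F x * δ * (1 + 2 * yv x * (1 - yv x) - δ * (1 - 2 * yv x))))
    (fun x => by
      have hy := hasDerivAt_yv x
      have ht := (hy.const_mul 2).const_sub 1
      have hA := (((((hn x).sub ((hg x).const_mul δ)).sub
        (((hg x).sub ((hh x).const_mul δ)).const_mul δ)).neg).mul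
        (hasDerivAt_exp_mul_left (-δ) x)).sub ((hasDerivAt_exp_mul_left (-1) x).const_mul ε)
      have hB := (((hy.const_mul 2).mul (hy.const_sub 1)).const_add 1).sub (ht.const_mul (2 * δ))
      refine (((hasDerivAt_exp_mul_left δ x).mul ((hasDerivAt_Q x).pow 2)).mul
        ((hA.mul ht).sub ((hFd x).mul hB))).congr_deriv ?_
      simp only [Pi.sub_apply, Pi.mul_apply, Pi.neg_apply, Pi.pow_apply, hF, hl]
      push_cast
      ring)
    (fun x => by
      have hQ := (Q_pos x).ne'
      have e : exp (3 * δ * x) * exp (-2 * δ * x) = exp (δ * x) := by rw [← exp_add]; ring_nf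
      rw [tauQ, ← e]
      field_simp) (fun x => mul_pos (exp_pos _) (pow_pos (Q_pos x) 3))
    (fun x hx => mul_pos (exp_pos _) (tauQ_pos (hz0.trans_le hx)))
    (fun x hx => by
      have hx0 := hz0.trans hx
      have hy0 := yv_pos x
      have hy1 := yv_lt_half hx0
      have hFx := hpos x hx
      have hhx := hepos x hx
      have t0 : 0 < 1 - 2 * yv x := by linarith
      have t1 : 0 < 1 - yv x := by linarith
      have p1 : 0 ≤ 3 + 3 * (1 - 2 * yv x) - 3 * δ + 3 * δ ^ 2 - 6 * (1 - 2 * yv x) * δ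
          + 10 * yv x * (1 - yv x) := by nlinarith [mul_pos hy0 t1]
      have p2 : 0 ≤ 1 + 2 * yv x * (1 - yv x) - δ * (1 - 2 * yv x) := by
        nlinarith [mul_pos hy0 t1]
      have := Q_pos x
      positivity) hlim le_rfl (by linarith)
  have hω0 := mul_pos (exp_pos (-2 * δ * z₀)) (tauQ_pos hz0)
  have hω1 := mul_pos (exp_pos (-2 * δ * (z₀ + 1))) (tauQ_pos (by linarith : 0 < z₀ + 1))
  have h1 : 0 < F (z₀ + 1) / (exp (-2 * δ * (z₀ + 1)) * tauQ (z₀ + 1)) :=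
    div_pos (hpos _ (by linarith)) hω1
  have h2 : F z₀ / (exp (-2 * δ * z₀) * tauQ z₀) ≤ 0 :=
    div_nonpos_of_nonpos_of_nonneg hFs hω0.le
  linarith

end Right

section Right

variable {h g n : ℝ → ℝ} {δ l b : ℝ}

lemma right_monotone (hδ : 0 < δ) (hδ1 : δ ≤ 1 / 5) (hl : l = δ * (1 - δ) * (2 - δ))
    (hh : ∀ x, HasDerivAt h (g x) x) (hg : ∀ x, HasDerivAt g (n x) x)
    (hn : ∀ x, HasDerivAt n
      (3 * (1 - 2 * yv x) * n x - (2 + 10 * yv x * (1 - yv x)) * g x + l * h x) x)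
    (hb0 : 0 < b) (hb : Tendsto (fun x => h x * exp (-δ * x)) atTop (nhds b))
    (hf : ExpBigO (fun x => g x - δ * h x) (-2)) (hf' : ExpBigO (fun x => n x - δ * g x) (-2)) :
    ∀ x, 0 ≤ x → 0 < h x ∧ h x ≤ h 0 * exp (δ * x) := by
  have hsign : ∀ x, 0 < x → (g x - δ * h x) * exp (-δ * x) ≤ 0 := by
    intro x hx
    by_contra hc
    push Not at hc
    have hp := exp_pos (-1 * x)
    set m := (g x - δ * h x) * exp (-δ * x) with hm
    have h1 := deriv_sign_perturbed hδ hδ1 hl hh hg hn hb hf hf'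
      (ε := min (b / 2) (m / 2)) (by positivity)
      ((min_le_left _ _).trans_lt (by linarith)) hx
    have h2 : exp (-1 * x) ≤ 1 := exp_le_one_iff.2 (by linarith)
    have h3 : min (b / 2) (m / 2) * exp (-1 * x) ≤ m / 2 * 1 :=
      mul_le_mul (min_le_right _ _) h2 hp.le (by linarith)
    linarith
  have hd : ∀ x, HasDerivAt (fun x => h x * exp (-δ * x))
      ((g x - δ * h x) * exp (-δ * x)) x := fun x =>
    ((hh x).mul (hasDerivAt_exp_mul_left (-δ) x)).congr_deriv (by ring)
  intro x hx
  have h1 := nonneg_of_deriv_nonpos (X := 0) (φ := fun x => h x * exp (-δ * x) - b)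
    (fun x => (hd x).sub_const b) hsign (by simpa using hb.sub_const b) hx
  refine ⟨pos_of_mul_pos_left (by linarith : 0 < h x * exp (-δ * x)) (exp_pos _).le, ?_⟩
  have hanti : AntitoneOn (fun x => h x * exp (-δ * x)) (Set.Ici 0) := by
    refine antitoneOn_of_deriv_nonpos (convex_Ici 0)
      (fun z _ => (hd z).continuousAt.continuousWithinAt)
      (fun z _ => (hd z).differentiableAt.differentiableWithinAt) fun z hz => ?_
    rw [interior_Ici] at hz
    rw [(hd z).deriv]; exact hsign z hz
  have h2 : h x * exp (-δ * x) ≤ h 0 * exp (-δ * 0) := hanti (Set.self_mem_Ici) hx hx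
  rw [mul_zero, exp_zero, mul_one] at h2
  have e : exp (-δ * x) * exp (δ * x) = 1 := by rw [← exp_add]; simp
  calc h x = h x * exp (-δ * x) * exp (δ * x) := by rw [mul_assoc, e, mul_one]
    _ ≤ _ := by gcongr

/-- Comparison of `g - k χ` with `tauQ`, where `χ = α + β t + κ t²` and `t = tanh(3x/2)`. -/
lemma comparison_tauQ (hδ1 : δ ≤ 1 / 5) (hg : ∀ x, HasDerivAt g (n x) x)
    (hn : ∀ x, HasDerivAt n
      (3 * (1 - 2 * yv x) * n x - (2 + 10 * yv x * (1 - yv x)) * g x + l * h x) x)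
    (bg : ExpBigO g δ) (bn : ExpBigO n δ) (hδ : 0 < δ) {k α β κ x₀ : ℝ} (hx₀ : 0 < x₀)
    (hpos : ∀ x, x₀ < x → k * (α * (2 + 10 * yv x * (1 - yv x))
      + β * (1 - 2 * yv x) * (2 - 26 * yv x * (1 - yv x))
      + κ * (72 * (yv x * (1 - yv x)) ^ 2 + (1 - 2 * yv x) ^ 2 * (2 - 62 * yv x * (1 - yv x))))
      ≤ l * h x) :
    k * (α + β * (1 - 2 * yv x₀) + κ * (1 - 2 * yv x₀) ^ 2) ≤ g x₀ := by
  have by0 : ExpBigO yv 0 := expBigO_yv.mono (by norm_num)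
  have byy : ExpBigO (fun x => yv x * (1 - yv x)) 0 := by
    simpa using by0.mul expBigO_one_sub_yv
  have bt : ExpBigO (fun x => 1 - 2 * yv x) 0 := (expBigO_const 1).sub (by0.const_mul 2)
  have btt : ExpBigO (fun x => (1 - 2 * yv x) * (1 - 2 * yv x)) 0 := by simpa using bt.mul bt
  have bχ : ExpBigO (fun x => α + β * (1 - 2 * yv x) + κ * (1 - 2 * yv x) ^ 2) 0 :=
    (((expBigO_const α).add (bt.const_mul β)).add (btt.const_mul κ)).congr_left fun x => by ring
  have bχ' : ExpBigO (fun x => (β + 2 * κ * (1 - 2 * yv x)) * (6 * yv x * (1 - yv x))) 0 := by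
    have := ((expBigO_const β).add (bt.const_mul (2 * κ))).mul (byy.const_mul 6)
    rw [add_zero] at this
    exact this.congr_left fun x => by ring
  have ht : ∀ x, HasDerivAt (fun x => 1 - 2 * yv x) (6 * yv x * (1 - yv x)) x := fun x =>
    (((hasDerivAt_yv x).const_mul 2).const_sub 1).congr_deriv (by ring)
  have hφ : ∀ x, HasDerivAt
      (fun x => g x - k * (α + β * (1 - 2 * yv x) + κ * (1 - 2 * yv x) ^ 2))
      (n x - k * ((β + 2 * κ * (1 - 2 * yv x)) * (6 * yv x * (1 - yv x)))) x := by
    intro x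
    refine ((hg x).sub (((((ht x).const_mul β).const_add α).add
      (((ht x).pow 2).const_mul κ)).const_mul k)).congr_deriv ?_
    push_cast; ring
  have bφ := bg.sub ((bχ.const_mul k).mono hδ.le)
  have bφ' := bn.sub ((bχ'.const_mul k).mono hδ.le)
  have hcomp : ∀ x, x₀ ≤ x →
      (g x - k * (α + β * (1 - 2 * yv x) + κ * (1 - 2 * yv x) ^ 2)) / tauQ x
      ≤ (g x₀ - k * (α + β * (1 - 2 * yv x₀) + κ * (1 - 2 * yv x₀) ^ 2)) / tauQ x₀ := by
    intro x hx
    refine div_le_div_of_wronskian (X := x₀) (ρ := fun x => Q x ^ 3) hφ hasDerivAt_tauQ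
      (W := fun x => Q x ^ 2 * ((n x - k * ((β + 2 * κ * (1 - 2 * yv x))
        * (6 * yv x * (1 - yv x)))) * (1 - 2 * yv x)
        - (g x - k * (α + β * (1 - 2 * yv x) + κ * (1 - 2 * yv x) ^ 2))
          * (1 + 2 * yv x * (1 - yv x))))
      (W' := fun x => Q x ^ 2 * (1 - 2 * yv x) * (l * h x
        - k * (α * (2 + 10 * yv x * (1 - yv x))
        + β * (1 - 2 * yv x) * (2 - 26 * yv x * (1 - yv x))
        + κ * (72 * (yv x * (1 - yv x)) ^ 2 + (1 - 2 * yv x) ^ 2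
          * (2 - 62 * yv x * (1 - yv x))))))
      (fun x => ?_) (fun x => ?_) (fun x => pow_pos (Q_pos x) 3)
      (fun x hx => tauQ_pos (hx₀.trans_le hx)) (fun x hx => ?_) ?_ le_rfl hx
    · have hy := hasDerivAt_yv x
      have hA := (hn x).sub ((((((ht x).const_mul (2 * κ)).const_add β).mul
        ((hy.const_mul 6).mul (hy.const_sub 1)))).const_mul k)
      have hB := ((hy.const_mul 2).mul (hy.const_sub 1)).const_add 1
      refine (((hasDerivAt_Q x).pow 2).mul ((hA.mul (ht x)).sub ((hφ x).mul hB))).congr_deriv ?_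
      simp only [Pi.sub_apply, Pi.mul_apply, Pi.pow_apply]
      push_cast
      ring
    · have hQ := (Q_pos x).ne'
      rw [tauQ]
      field_simp
    · have h1 := hpos x hx
      have h2 := yv_lt_half (hx₀.trans hx)
      have := Q_pos x
      exact mul_nonneg (mul_nonneg (by positivity) (by linarith)) (by linarith)
    · have c1 := bφ'.mul bt
      have c2 := bφ.mul ((expBigO_const 1).add (byy.const_mul 2))
      rw [add_zero] at c1 c2
      refine (((expBigO_Q.mul expBigO_Q).mul (c1.sub c2)).tendsto_zero (by linarith)).congr
        fun x => ?_
      ring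
  have hle := le_of_tendsto (bφ.tendsto_div_tauQ (by linarith))
    (by filter_upwards [eventually_ge_atTop x₀] with x hx using hcomp x hx)
  have := tauQ_pos hx₀
  have h0 : 0 ≤ (g x₀ - k * (α + β * (1 - 2 * yv x₀) + κ * (1 - 2 * yv x₀) ^ 2)) := by
    by_contra hc
    push Not at hc
    exact absurd (div_neg_of_neg_of_pos hc this) (not_lt.2 hle)
  linarith

/-- Bounds at `0` for a solution of the reduced system growing like `e^{δx}`. -/
lemma right_bounds (hδ : 0 < δ) (hδ1 : δ ≤ 147 / 1000) (hl : l = δ * (1 - δ) * (2 - δ))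
    (hh : ∀ x, HasDerivAt h (g x) x) (hg : ∀ x, HasDerivAt g (n x) x)
    (hn : ∀ x, HasDerivAt n
      (3 * (1 - 2 * yv x) * n x - (2 + 10 * yv x * (1 - yv x)) * g x + l * h x) x)
    (hb0 : 0 < b) (hb : Tendsto (fun x => h x * exp (-δ * x)) atTop (nhds b))
    (hf : ExpBigO (fun x => g x - δ * h x) (-2)) (hf' : ExpBigO (fun x => n x - δ * g x) (-2)) :
    0 < h 0 ∧ 0 ≤ g 0 ∧ g 0 ≤ l * (1 / 3 + 67 / 150 * δ) * h 0 ∧ 28 / 100 * l * h 0 ≤ n 0 := by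
  have hδ2 : δ ≤ 1 / 5 := by linarith
  have hl0 : 0 < l := by
    rw [hl]; exact mul_pos (mul_pos hδ (by linarith)) (by linarith)
  have hmon := right_monotone hδ hδ2 hl hh hg hn hb0 hb hf hf'
  have bh : ExpBigO h δ := by
    have := ExpBigO.of_tendsto hb
    rwa [neg_neg] at this
  have bg : ExpBigO g δ :=
    ((hf.mono (by linarith : -2 ≤ δ)).add (bh.const_mul δ)).congr_left fun x => by ring
  have bn : ExpBigO n δ :=
    ((hf'.mono (by linarith : -2 ≤ δ)).add (bg.const_mul δ)).congr_left fun x => by ring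
  have hgpos : ∀ x, 0 < x → 0 ≤ g x := by
    intro x hx
    have := comparison_tauQ (k := 0) (α := 0) (β := 0) (κ := 0) hδ2 hg hn bg bn hδ hx
      (fun z hz => by
        have := mul_pos hl0 (hmon z (hx.trans hz).le).1
        linarith)
    linarith
  have hhmono : MonotoneOn h (Set.Ici 0) := by
    refine monotoneOn_of_deriv_nonneg (convex_Ici 0)
      (fun z _ => (hh z).continuousAt.continuousWithinAt)
      (fun z _ => (hh z).differentiableAt.differentiableWithinAt) fun z hz => ?_
    rw [interior_Ici] at hz
    rw [(hh z).deriv]; exact hgpos z hz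
  have hg0 : 0 ≤ g 0 := by
    refine ge_of_tendsto ((hg 0).continuousAt.tendsto.mono_left
      (nhdsWithin_le_nhds (s := Set.Ioi 0))) ?_
    filter_upwards [self_mem_nhdsWithin] with x hx using hgpos x hx
  have by0 : ExpBigO yv 0 := expBigO_yv.mono (by norm_num)
  have byy : ExpBigO (fun x => yv x * (1 - yv x)) 0 := by
    simpa using by0.mul expBigO_one_sub_yv
  have bt : ExpBigO (fun x => 1 - 2 * yv x) 0 := (expBigO_const 1).sub (by0.const_mul 2)
  have h0 := (hmon 0 le_rfl).1
  have hq := Q_pos 0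
  refine ⟨h0, hg0, ?_, ?_⟩
  · have hd : ∀ x, HasDerivAt (fun x => Q x ^ 2 * (l * h 0 * (1 / 2 + 67 / 100 * δ
          - 2 / 5 * δ * (1 - 2 * yv x)) * exp (δ * x)
          + (n x * (1 - 2 * yv x) - g x * (1 + 2 * yv x * (1 - yv x)))))
        (Q x ^ 2 * (l * h x * (1 - 2 * yv x) - l * h 0 * exp (δ * x) *
          (2 * (1 - 2 * yv x) * (1 / 2 + 67 / 100 * δ - 2 / 5 * δ * (1 - 2 * yv x))
            + 12 / 5 * δ * (yv x * (1 - yv x))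
            - δ * (1 / 2 + 67 / 100 * δ - 2 / 5 * δ * (1 - 2 * yv x))))) x := by
      intro x
      have hy := hasDerivAt_yv x
      have ht := (hy.const_mul 2).const_sub 1
      have hB := ((hy.const_mul 2).mul (hy.const_sub 1)).const_add 1
      have hA := (((ht.const_mul (2 / 5 * δ)).const_sub (1 / 2 + 67 / 100 * δ)).const_mul
        (l * h 0)).mul (hasDerivAt_exp_mul_left δ x)
      refine (((hasDerivAt_Q x).pow 2).mul (hA.add (((hn x).mul ht).sub
        ((hg x).mul hB)))).congr_deriv ?_
      simp only [Pi.sub_apply, Pi.mul_apply, Pi.pow_apply, Pi.add_apply]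
      push_cast
      ring
    have hres := nonneg_of_deriv_nonpos (X := 0) hd (fun x hx => ?_) ?_ le_rfl
    · simp only [yv_zero, mul_zero, exp_zero] at hres
      have := nonneg_of_mul_nonneg_right hres (by positivity)
      linarith
    · have hy0 := yv_pos x
      have hy1 := yv_le_half hx.le
      have hhx := (hmon x hx.le).2
      have hE := exp_pos (δ * x)
      have ht0 : 0 ≤ 1 - 2 * yv x := by linarith
      have h1 : l * h x * (1 - 2 * yv x) ≤ l * (h 0 * exp (δ * x)) * (1 - 2 * yv x) := by gcongr
      have h2 : 1 - 2 * yv x ≤ 2 * (1 - 2 * yv x) * (1 / 2 + 67 / 100 * δ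
          - 2 / 5 * δ * (1 - 2 * yv x)) + 12 / 5 * δ * (yv x * (1 - yv x))
            - δ * (1 / 2 + 67 / 100 * δ - 2 / 5 * δ * (1 - 2 * yv x)) := by
        have hp : 0 ≤ 1 / 10 + 134 / 100 * (1 - 2 * yv x) - 14 / 10 * (1 - 2 * yv x) ^ 2
            - 67 / 100 * δ + 4 / 10 * δ * (1 - 2 * yv x) := by nlinarith
        linear_combination δ * hp
      have h3 := mul_le_mul_of_nonneg_left h2 (by positivity : 0 ≤ l * h 0 * exp (δ * x))
      refine mul_nonpos_of_nonneg_of_nonpos (sq_nonneg _) ?_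
      linarith
    · have c0 := (((expBigO_const (1 / 2 + 67 / 100 * δ)).sub (bt.const_mul (2 / 5 * δ))).const_mul
        (l * h 0)).mul (expBigO_exp δ)
      rw [zero_add] at c0
      have c1 := bn.mul bt
      have c2 := bg.mul ((expBigO_const 1).add (byy.const_mul 2))
      rw [add_zero] at c1 c2
      refine (((expBigO_Q.mul expBigO_Q).mul (c0.add (c1.sub c2))).tendsto_zero
        (by linarith)).congr fun x => ?_
      ring
  · have hlow : ∀ x, 0 < x → l * h x * (28 / 100 + 28 / 100 * (1 - 2 * yv x)
        + -6 / 100 * (1 - 2 * yv x) ^ 2) ≤ g x := by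
      intro x hx
      refine comparison_tauQ hδ2 hg hn bg bn hδ hx fun z hz => ?_
      have hz0 := hx.trans hz
      have hmz : h x ≤ h z := hhmono (le_of_lt hx : (0:ℝ) ≤ x) (hz0.le : (0:ℝ) ≤ z) hz.le
      have hhx := (hmon x hx.le).1
      have hy0 := yv_pos z
      have hy1 := yv_le_half hz0.le
      have hle : 28 / 100 * (2 + 10 * yv z * (1 - yv z))
          + 28 / 100 * (1 - 2 * yv z) * (2 - 26 * yv z * (1 - yv z))
          + -6 / 100 * (72 * (yv z * (1 - yv z)) ^ 2
            + (1 - 2 * yv z) ^ 2 * (2 - 62 * yv z * (1 - yv z))) ≤ 1 := by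
        obtain ⟨t, ht⟩ : ∃ t, t = 1 - 2 * yv z := ⟨_, rfl⟩
        have ht0 : 0 ≤ t := by linarith
        have ht1 : 0 ≤ 1 - t := by linarith
        have hy : yv z = (1 - t) / 2 := by linarith
        have hp : 0 ≤ (1 - t) * (1 / 100 + 7 / 100 * t + 62 / 100 * t ^ 2
            + 12 / 10 * t * (1 - t) * (1 + t)) := by positivity
        rw [hy]
        linarith
      calc _ ≤ l * h x * 1 := mul_le_mul_of_nonneg_left hle (by positivity)
        _ ≤ l * h z := by rw [mul_one]; gcongr
    have hd : ∀ x, HasDerivAt (fun x => 10 * (yv x * (1 - yv x)) * n x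
        - l * h 0 * (5 / 3) * (253 / 600 - (26 / 100 * (1 - 2 * yv x)
          + 63 / 100 * (1 - 2 * yv x) ^ 2
          - 97 / 300 * (1 - 2 * yv x) ^ 3 - 7 / 40 * (1 - 2 * yv x) ^ 4
          + 3 / 100 * (1 - 2 * yv x) ^ 5)))
        (10 * (yv x * (1 - yv x)) * (l * h x - (2 + 10 * yv x * (1 - yv x)) * g x
          + l * h 0 * (26 / 100 + 126 / 100 * (1 - 2 * yv x) - 97 / 100 * (1 - 2 * yv x) ^ 2
            - 7 / 10 * (1 - 2 * yv x) ^ 3 + 15 / 100 * (1 - 2 * yv x) ^ 4))) x := by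
      intro x
      have hy := hasDerivAt_yv x
      have ht := (hy.const_mul 2).const_sub 1
      have hZ := (((((ht.const_mul (26 / 100)).add ((ht.pow 2).const_mul (63 / 100))).sub
        ((ht.pow 3).const_mul (97 / 300))).sub ((ht.pow 4).const_mul (7 / 40))).add
        ((ht.pow 5).const_mul (3 / 100))).const_sub (253 / 600)
      refine ((((hy.mul (hy.const_sub 1)).const_mul 10).mul (hn x)).sub
        (hZ.const_mul (l * h 0 * (5 / 3)))).congr_deriv ?_
      simp only [Pi.mul_apply]
      push_cast
      ring
    have hres := nonneg_of_deriv_nonpos (X := 0) hd (fun x hx => ?_) ?_ le_rfl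
    · simp only [yv_zero] at hres
      have := mul_pos hl0 h0
      norm_num at hres
      linarith
    · have hy0 := yv_pos x
      have hy1 := yv_le_half hx.le
      have hy2 : 0 < 1 - yv x := by linarith
      have hgx := hlow x hx
      have hhx := (hmon x hx.le).1
      have hmx : h 0 ≤ h x := hhmono (Set.self_mem_Ici) hx.le hx.le
      set t := 1 - 2 * yv x with ht
      have ht0 : 0 ≤ t := by rw [ht]; linarith
      have ht1 : t ≤ 1 := by rw [ht]; linarith
      have ey : 10 * yv x * (1 - yv x) = 5 / 2 * (1 - t ^ 2) := by rw [ht]; ring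
      have hZ : 0 ≤ 26 / 100 + 126 / 100 * t - 97 / 100 * t ^ 2 - 7 / 10 * t ^ 3
          + 15 / 100 * t ^ 4 := by
        have : 0 ≤ (1 - t) * (26 / 100 + 152 / 100 * t + 55 / 100 * t ^ 2 - 15 / 100 * t ^ 3) := by
          refine mul_nonneg (by linarith) ?_
          nlinarith [pow_nonneg ht0 2, mul_nonneg (pow_nonneg ht0 2) (sub_nonneg.2 ht1)]
        linarith
      refine mul_nonpos_of_nonneg_of_nonpos (by positivity) ?_
      have h1 : 0 ≤ (2 + 10 * yv x * (1 - yv x)) := by positivity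
      have h2 := mul_le_mul_of_nonneg_left hgx h1
      have h3 := mul_le_mul_of_nonneg_left hmx hl0.le
      have h4 := mul_le_mul_of_nonneg_right h3 hZ
      rw [ey] at h2 ⊢
      linarith
    · have c1 := (expBigO_yv.mul expBigO_one_sub_yv).const_mul 10
      rw [add_zero] at c1
      have c2 := (c1.mul bn).tendsto_zero (by linarith)
      have t1 : Tendsto (fun x => 1 - 2 * yv x) atTop (nhds (1 - 2 * 0)) :=
        (tendsto_yv.const_mul 2).const_sub 1
      have := c2.sub (((((((t1.const_mul (26 / 100)).add ((t1.pow 2).const_mul (63 / 100))).sub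
        ((t1.pow 3).const_mul (97 / 300))).sub ((t1.pow 4).const_mul (7 / 40))).add
        ((t1.pow 5).const_mul (3 / 100))).const_sub (253 / 600)).const_mul (l * h 0 * (5 / 3)))
      convert this using 2
      norm_num

end Right

/-! ### First order linear equations with exponentially decaying forcing -/

section LinearODE

variable {f r : ℝ → ℝ} {a k : ℝ}

lemma hasDerivAt_mul_exp (hd : ∀ x, HasDerivAt f (a * f x + r x) x) (x : ℝ) :
    HasDerivAt (fun x => f x * exp (-a * x)) (r x * exp (-a * x)) x := by
  refine ((hd x).mul (hasDerivAt_exp_mul_left (-a) x)).congr_deriv ?_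
  ring

lemma abs_le_of_linear_ode {K X : ℝ} (hak : 0 < a + k)
    (hd : ∀ x, HasDerivAt f (a * f x + r x) x) (hK : ∀ x, X ≤ x → |r x| ≤ K * exp (-k * x))
    (h0 : Tendsto (fun x => f x * exp (-a * x)) atTop (nhds 0)) :
    ∀ x, X ≤ x → |f x| ≤ K / (a + k) * exp (-k * x) := by
  have hsplit : ∀ x, exp (-(a + k) * x) = exp (-k * x) * exp (-a * x) := fun x => by
    rw [← exp_add]; ring_nf
  have h := abs_le_of_deriv_abs_le (X := X) (K := K) hak (hasDerivAt_mul_exp hd) (fun x hx => ?_) h0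
  · intro x hx
    have := h x hx
    rw [abs_mul, abs_of_pos (exp_pos _), hsplit, ← mul_assoc] at this
    exact le_of_mul_le_mul_right this (exp_pos _)
  · rw [abs_mul, abs_of_pos (exp_pos _), hsplit, ← mul_assoc]
    exact mul_le_mul_of_nonneg_right (hK x hx) (exp_pos _).le

lemma ExpBigO.exists_bound (hf : ExpBigO f a) :
    ∃ K X : ℝ, ∀ x, X ≤ x → |f x| ≤ K * exp (a * x) := by
  obtain ⟨K, hK⟩ := Asymptotics.IsBigO.bound hf
  obtain ⟨X, hX⟩ := eventually_atTop.1 hK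
  refine ⟨K, X, fun x hx => ?_⟩
  have := hX x hx
  rwa [norm_of_nonneg (exp_pos _).le] at this

lemma ExpBigO.of_linear_ode (hak : 0 < a + k) (hd : ∀ x, HasDerivAt f (a * f x + r x) x)
    (hr : ExpBigO r (-k)) (h0 : Tendsto (fun x => f x * exp (-a * x)) atTop (nhds 0)) :
    ExpBigO f (-k) := by
  obtain ⟨K, X, hK⟩ := hr.exists_bound
  refine Asymptotics.IsBigO.of_bound (K / (a + k)) ?_
  filter_upwards [eventually_ge_atTop X] with x hx
  rw [norm_of_nonneg (exp_pos _).le]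
  exact abs_le_of_linear_ode hak hd hK h0 x hx

lemma exists_tendsto_of_linear_ode (hak : 0 < a + k) (hd : ∀ x, HasDerivAt f (a * f x + r x) x)
    (hrc : Continuous r) (hr : ExpBigO r (-k)) :
    ∃ l, Tendsto (fun x => f x * exp (-a * x)) atTop (nhds l) := by
  refine ⟨_, tendsto_limUnder_of_hasDerivAt_of_integrableOn_Ioi (a := 0)
    (fun x _ => hasDerivAt_mul_exp hd x) ?_⟩
  refine integrable_of_isBigO_exp_neg hak (by fun_prop) ?_
  have h := hr.mul (expBigO_exp (-a))
  rwa [← neg_add, add_comm k a] at h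

end LinearODE

/-! ### Asymptotics of the solution at `+∞` -/

section Asymptotics

variable {A A' A'' : ℝ → ℝ} {s γ l : ℝ}

/-- `A'' - A + Q³ (4A + e^{-sx})`, the opposite of the quantity differentiated in the equation. -/
noncomputable def flux (s : ℝ) (A A'' : ℝ → ℝ) (x : ℝ) : ℝ :=
  A'' x - A x + Q x ^ 3 * (4 * A x + exp (-s * x))

lemma expBigO_Q_cube : ExpBigO (fun x => Q x ^ 3) (-3) := by
  have h := ((expBigO_Q.mul expBigO_Q).mul expBigO_Q)
  norm_num at h
  exact h.congr_left fun x => by ring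

lemma Q_cube_le (x : ℝ) : |Q x ^ 3| ≤ 10 * exp (-3 * x) := by
  have h1 := yv_pos x
  have h2 := yv_lt_one x
  rw [Q_cube, abs_of_pos (mul_pos (by linarith) (by linarith))]
  have h3 := yv_le_exp x
  nlinarith

/-- The outgoing combination `A'' + (s+γ) A' + sγ A + Q³(4A + e^{-sx})`. -/
lemma hasDerivAt_outgoing (hrel : s ^ 2 + s * γ + γ ^ 2 = 1) (hl : l = s * γ * (s + γ))
    (hA : ∀ x, HasDerivAt A (A' x) x) (hA' : ∀ x, HasDerivAt A' (A'' x) x)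
    (hM : ∀ x, HasDerivAt (flux s A A'') (l * A x) x) (x : ℝ) :
    HasDerivAt (fun x => flux s A A'' x + (s + γ) * A' x + (1 + s * γ) * A x)
      ((s + γ) * (flux s A A'' x + (s + γ) * A' x + (1 + s * γ) * A x)
        + -(s + γ) * (Q x ^ 3 * (4 * A x + exp (-s * x)))) x := by
  refine (((hM x).add ((hA' x).const_mul (s + γ))).add
    ((hA x).const_mul (1 + s * γ))).congr_deriv ?_
  rw [hl]
  simp only [flux]
  linear_combination (-A' x) * hrel

lemma hasDerivAt_sub_exp {f r : ℝ → ℝ} {a : ℝ}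
    (hd : ∀ x, HasDerivAt f (a * f x + r x) x) (k x : ℝ) :
    HasDerivAt (fun x => f x - k * exp (a * x)) (a * (f x - k * exp (a * x)) + r x) x := by
  refine ((hd x).sub ((hasDerivAt_exp_mul_left a x).const_mul k)).congr_deriv ?_
  ring

lemma tendsto_sub_exp {f : ℝ → ℝ} {a k : ℝ}
    (h : Tendsto (fun x => f x * exp (-a * x)) atTop (nhds k)) :
    Tendsto (fun x => (f x - k * exp (a * x)) * exp (-a * x)) atTop (nhds 0) := by
  have := h.sub_const k
  rw [sub_self] at this
  refine this.congr fun x => ?_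
  rw [sub_mul, mul_assoc k, ← exp_add]; simp

lemma expBigO_outgoing (hγ : 0 < γ) (hs : 0 < s) (hrel : s ^ 2 + s * γ + γ ^ 2 = 1)
    (hl : l = s * γ * (s + γ))
    (hA : ∀ x, HasDerivAt A (A' x) x) (hA' : ∀ x, HasDerivAt A' (A'' x) x)
    (hM : ∀ x, HasDerivAt (flux s A A'') (l * A x) x)
    (bA : ExpBigO A 0) (bA' : ExpBigO A' 0) (bA'' : ExpBigO A'' 0) :
    ExpBigO (fun x => A'' x + (s + γ) * A' x + s * γ * A x) (-3) := by
  have bB : ExpBigO (fun x => 4 * A x + exp (-s * x)) 0 :=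
    (bA.const_mul 4).add ((expBigO_exp (-s)).mono (by linarith))
  have bQB := expBigO_Q_cube.mul bB
  rw [add_zero] at bQB
  have bM : ExpBigO (flux s A A'') 0 := (bA''.sub bA).add (bQB.mono (by norm_num))
  have h := ExpBigO.of_linear_ode (k := 3) (by linarith)
    (hasDerivAt_outgoing hrel hl hA hA' hM) (bQB.const_mul _) ?_
  · refine (h.sub bQB).congr_left fun x => ?_
    simp only [flux]; ring
  · have h2 := (((bM.add (bA'.const_mul (s + γ))).add (bA.const_mul (1 + s * γ))).mul
      (expBigO_exp (-(s + γ))))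
    rw [zero_add] at h2
    exact h2.tendsto_zero (by linarith)

lemma exists_tendsto_right (hγ : 0 < γ) (hγs : γ < s) (hs1 : s ≤ 1)
    (hrel : s ^ 2 + s * γ + γ ^ 2 = 1) (hl : l = s * γ * (s + γ))
    (hA : ∀ x, HasDerivAt A (A' x) x) (hA' : ∀ x, HasDerivAt A' (A'' x) x)
    (hc : Continuous A'') (hM : ∀ x, HasDerivAt (flux s A A'') (l * A x) x)
    (bA : ExpBigO A 0) (bA' : ExpBigO A' 0) (bA'' : ExpBigO A'' 0) :
    ∃ α, Tendsto (fun x => A x * exp (γ * x)) atTop (nhds α) ∧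
      (α = 0 → ExpBigO (fun x => A' x + s * A x) (-3) ∧
        ∃ β, Tendsto (fun x => A x * exp (s * x)) atTop (nhds β)) := by
  have bw := expBigO_outgoing hγ (hγ.trans hγs) hrel hl hA hA' hM bA bA' bA''
  have cA : Continuous A := continuous_iff_continuousAt.2 fun x => (hA x).continuousAt
  have cA' : Continuous A' := continuous_iff_continuousAt.2 fun x => (hA' x).continuousAt
  have hp : ∀ x, HasDerivAt (fun x => A' x + s * A x)
      (-γ * (A' x + s * A x) + (A'' x + (s + γ) * A' x + s * γ * A x)) x := fun x => by
    refine ((hA' x).add ((hA x).const_mul s)).congr_deriv ?_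
    ring
  obtain ⟨ℓ, hℓ⟩ := exists_tendsto_of_linear_ode (k := 3) (by linarith) hp (by fun_prop) bw
  have bp := ExpBigO.of_linear_ode (k := 3) (by linarith) (hasDerivAt_sub_exp hp ℓ) bw
    (tendsto_sub_exp hℓ)
  obtain ⟨α, hα⟩ : ∃ α, α = ℓ / (s - γ) := ⟨_, rfl⟩
  have hαl : ℓ = α * (s - γ) := by
    rw [hα, div_mul_cancel₀]; linarith
  have hT : ∀ x, HasDerivAt (fun x => A x - α * exp (-γ * x))
      (-s * (A x - α * exp (-γ * x)) + (A' x + s * A x - ℓ * exp (-γ * x))) x := fun x => by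
    refine ((hA x).sub ((hasDerivAt_exp_mul_left (-γ) x).const_mul α)).congr_deriv ?_
    rw [hαl]; ring
  obtain ⟨β, hβ⟩ := exists_tendsto_of_linear_ode (k := 3) (by linarith) hT (by fun_prop) bp
  rw [neg_neg] at hβ
  refine ⟨α, ?_, fun hα0 => ⟨?_, β, ?_⟩⟩
  · have h1 := ((ExpBigO.of_tendsto hβ).mul (expBigO_exp γ)).tendsto_zero (by linarith)
    have h2 := h1.add_const α
    rw [zero_add] at h2
    refine h2.congr fun x => ?_
    rw [sub_mul, mul_assoc α, ← exp_add]; simp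
  · simpa [hαl, hα0] using bp
  · simpa [hα0] using hβ

lemma eventually_zero_of_tail (hγ : 0 < γ) (hγs : γ < s) (hs1 : s ≤ 1)
    (hrel : s ^ 2 + s * γ + γ ^ 2 = 1) (hl : l = s * γ * (s + γ))
    (hA : ∀ x, HasDerivAt A (A' x) x) (hA' : ∀ x, HasDerivAt A' (A'' x) x)
    (hM : ∀ x, HasDerivAt (flux s A A'') (l * A x) x)
    (bA : ExpBigO A 0) (bA' : ExpBigO A' 0) (bA'' : ExpBigO A'' 0)
    (bp : ExpBigO (fun x => A' x + s * A x) (-3))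
    (hb : Tendsto (fun x => (4 * A x + exp (-s * x)) * exp (s * x)) atTop (nhds 0)) :
    ∃ X, ∀ x, X ≤ x → 4 * A x + exp (-s * x) = 0 := by
  have bB : ExpBigO (fun x => 4 * A x + exp (-s * x)) (-s) := ExpBigO.of_tendsto hb
  have bQB := expBigO_Q_cube.mul bB
  have bM : ExpBigO (flux s A A'') 0 := (bA''.sub bA).add (bQB.mono (by linarith))
  have hp : ∀ x, HasDerivAt (fun x => A' x + s * A x)
      (-γ * (A' x + s * A x) + (A'' x + (s + γ) * A' x + s * γ * A x)) x := fun x => by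
    refine ((hA' x).add ((hA x).const_mul s)).congr_deriv ?_
    ring
  have hB : ∀ x, HasDerivAt (fun x => 4 * A x + exp (-s * x))
      (-s * (4 * A x + exp (-s * x)) + 4 * (A' x + s * A x)) x := fun x => by
    refine (((hA x).const_mul 4).add (hasDerivAt_exp_mul_left (-s) x)).congr_deriv ?_
    ring
  have hw0 : Tendsto (fun x => (flux s A A'' x + (s + γ) * A' x + (1 + s * γ) * A x)
      * exp (-(s + γ) * x)) atTop (nhds 0) := by
    have h2 := (((bM.add (bA'.const_mul (s + γ))).add (bA.const_mul (1 + s * γ))).mul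
      (expBigO_exp (-(s + γ))))
    rw [zero_add] at h2
    exact h2.tendsto_zero (by linarith)
  have hp0 : Tendsto (fun x => (A' x + s * A x) * exp (-(-γ) * x)) atTop (nhds 0) :=
    (bp.mul (expBigO_exp (-(-γ)))).tendsto_zero (by linarith)
  obtain ⟨K, X₀, hK⟩ := bB.exists_bound
  have step : ∀ N, (∀ x, max X₀ 2 ≤ x → |4 * A x + exp (-s * x)| ≤ N * exp (-s * x)) →
      ∀ x, max X₀ 2 ≤ x → |4 * A x + exp (-s * x)| ≤ N / 2 * exp (-s * x) := by
    intro N hN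
    have hN0 : 0 ≤ N := by
      have := (abs_nonneg _).trans (hN _ le_rfl)
      exact nonneg_of_mul_nonneg_left this (exp_pos _)
    have hsplit : ∀ x, exp (-(3 + s) * x) = exp (-3 * x) * exp (-s * x) := fun x => by
      rw [← exp_add]; ring_nf
    have hQB : ∀ x, max X₀ 2 ≤ x →
        |Q x ^ 3 * (4 * A x + exp (-s * x))| ≤ 10 * N * exp (-(3 + s) * x) := fun x hx => by
      rw [abs_mul, hsplit]
      calc _ ≤ (10 * exp (-3 * x)) * (N * exp (-s * x)) :=
            mul_le_mul (Q_cube_le x) (hN x hx) (abs_nonneg _) (by positivity)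
        _ = _ := by ring
    have h1 := abs_le_of_linear_ode (X := max X₀ 2) (K := 10 * N * (s + γ)) (k := 3 + s)
      (by linarith) (hasDerivAt_outgoing hrel hl hA hA' hM) (fun x hx => by
        rw [abs_mul, abs_neg, abs_of_pos (by linarith : 0 < s + γ)]
        have := mul_le_mul_of_nonneg_left (hQB x hx) (by linarith : 0 ≤ s + γ)
        linarith) hw0
    have h2 : ∀ x, max X₀ 2 ≤ x → |A'' x + (s + γ) * A' x + s * γ * A x|
        ≤ 20 * N * exp (-(3 + s) * x) := fun x hx => by
      have e1 := h1 x hx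
      have e2 := hQB x hx
      have e3 : 10 * N * (s + γ) / (s + γ + (3 + s)) ≤ 10 * N := by
        rw [div_le_iff₀ (by linarith)]
        exact mul_le_mul_of_nonneg_left (by linarith) (by positivity)
      have e4 := mul_le_mul_of_nonneg_right e3 (exp_pos (-(3 + s) * x)).le
      calc _ = |(flux s A A'' x + (s + γ) * A' x + (1 + s * γ) * A x)
            - Q x ^ 3 * (4 * A x + exp (-s * x))| := by congr 1; simp only [flux]; ring
        _ ≤ _ := abs_sub _ _
        _ ≤ _ := by linarith
    have h3 := abs_le_of_linear_ode (X := max X₀ 2) (k := 3 + s) (by linarith) hp h2 hp0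
    have h4 := abs_le_of_linear_ode (X := max X₀ 2) (K := 40 * N) (k := 3 + s) (by linarith) hB
      (fun x hx => by
        have e1 := h3 x hx
        have e3 : 20 * N / (-γ + (3 + s)) ≤ 10 * N := by
          rw [div_le_iff₀ (by linarith)]
          nlinarith
        have e4 := mul_le_mul_of_nonneg_right e3 (exp_pos (-(3 + s) * x)).le
        rw [abs_mul, abs_of_pos (by norm_num : (0:ℝ) < 4)]
        linarith) (by simpa using hb)
    intro x hx
    refine (h4 x hx).trans ?_
    rw [hsplit, ← mul_assoc]
    refine mul_le_mul_of_nonneg_right ?_ (exp_pos _).le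
    have hx2 : 2 ≤ x := (le_max_right _ _).trans hx
    have e5 : exp (-3 * x) ≤ 1 / 32 := by
      have f1 : exp (-3 * x) ≤ exp (-6) := exp_le_exp.2 (by linarith)
      have f2 : (32:ℝ) ≤ exp 6 := by
        have f3 : (2:ℝ) ≤ exp 1 := by linarith [add_one_le_exp (1:ℝ)]
        have f4 : exp 6 = exp 1 ^ 6 := by rw [← exp_nat_mul]; norm_num
        rw [f4]
        calc (32:ℝ) ≤ 2 ^ 6 := by norm_num
          _ ≤ _ := by gcongr
      rw [exp_neg] at f1
      refine f1.trans ?_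
      rw [one_div]
      exact inv_anti₀ (by norm_num) f2
    have e6 : -s + (3 + s) = 3 := by ring
    rw [e6]
    nlinarith
  have iter : ∀ m : ℕ, ∀ x, max X₀ 2 ≤ x →
      |4 * A x + exp (-s * x)| ≤ K / 2 ^ m * exp (-s * x) := by
    intro m
    induction m with
    | zero => intro x hx; simpa using hK x ((le_max_left _ _).trans hx)
    | succ m ih =>
      have := step _ ih
      intro x hx
      have := this x hx
      rwa [div_div, ← pow_succ] at this
  refine ⟨max X₀ 2, fun x hx => ?_⟩
  have hlim : Tendsto (fun m : ℕ => K / 2 ^ m * exp (-s * x)) atTop (nhds 0) := by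
    have h := ((tendsto_pow_atTop_nhds_zero_of_lt_one (r := (1 / 2 : ℝ)) (by norm_num)
      (by norm_num)).const_mul K).mul_const (exp (-s * x))
    simp only [mul_zero, zero_mul] at h
    refine h.congr fun m => ?_
    rw [one_div, inv_pow, div_eq_mul_inv]
  have := ge_of_tendsto' hlim fun m => iter m x hx
  exact abs_nonpos_iff.1 this

end Asymptotics

/-! ### The homogeneous equation `v''' = v' - 4Q³v' + l v` -/

section Homogeneous

variable {v u w : ℝ → ℝ} {s γ δ l : ℝ}

/-- A solution that vanishes with its derivatives at one point vanishes to the left of it. -/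
lemma eq_zero_of_eq_zero_right {X : ℝ} (hl : |l| ≤ 1)
    (hv : ∀ x, HasDerivAt v (u x) x) (hu : ∀ x, HasDerivAt u (w x) x)
    (hw : ∀ x, HasDerivAt w (u x - 40 * yv x * (1 - yv x) * u x + l * v x) x)
    (hvX : v X = 0) (huX : u X = 0) (hwX : w X = 0) {x : ℝ} (hx : x ≤ X) : u x = 0 := by
  have hd : ∀ x, HasDerivAt (fun x => (v x ^ 2 + u x ^ 2 + w x ^ 2) * exp (30 * x))
      ((2 * v x * u x + 2 * u x * w x + 2 * w x * (u x - 40 * yv x * (1 - yv x) * u x + l * v x)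
        + 30 * (v x ^ 2 + u x ^ 2 + w x ^ 2)) * exp (30 * x)) x := fun x => by
    refine (((((hv x).pow 2).add ((hu x).pow 2)).add ((hw x).pow 2)).mul
      (hasDerivAt_exp_mul_left 30 x)).congr_deriv ?_
    simp only [Pi.add_apply, Pi.pow_apply]
    push_cast
    ring
  have hmono := monotone_of_deriv_nonneg (fun x => (hd x).differentiableAt) fun x => by
    rw [(hd x).deriv]
    refine mul_nonneg ?_ (exp_pos _).le
    have hy := yv_pos x
    have hy1 := yv_lt_one x
    obtain ⟨κ, hκ⟩ : ∃ κ, κ = 40 * yv x * (1 - yv x) := ⟨_, rfl⟩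
    have k0 : 0 ≤ κ := by rw [hκ]; exact mul_nonneg (by linarith) (by linarith)
    have k1 : κ ≤ 10 := by rw [hκ]; nlinarith [sq_nonneg (1 - 2 * yv x)]
    rw [← hκ]
    obtain ⟨l1, l2⟩ := abs_le.1 hl
    nlinarith [sq_nonneg (v x + u x), sq_nonneg (u x + w x), sq_nonneg (u x - w x),
      mul_nonneg k0 (sq_nonneg (u x - w x)), mul_nonneg k0 (sq_nonneg (u x + w x)),
      mul_nonneg (sub_nonneg.2 k1) (sq_nonneg (u x)),
      mul_nonneg (sub_nonneg.2 k1) (sq_nonneg (w x)),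
      mul_nonneg (by linarith : 0 ≤ 1 + l) (sq_nonneg (v x + w x)),
      mul_nonneg (by linarith : 0 ≤ 1 - l) (sq_nonneg (v x - w x)),
      sq_nonneg (v x), sq_nonneg (w x)]
  have h := hmono hx
  simp only [hvX, huX, hwX] at h
  have h2 : (v x ^ 2 + u x ^ 2 + w x ^ 2) ≤ 0 := by
    have := exp_pos (30 * x)
    by_contra hc
    have := mul_pos (not_le.1 hc) this
    norm_num at h
    linarith
  exact pow_eq_zero_iff (two_ne_zero) |>.1
    (le_antisymm (by nlinarith [sq_nonneg (v x), sq_nonneg (w x)]) (sq_nonneg (u x)))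

/-- The pairing with the dual solution, reflected through the origin, is constant. -/
lemma pairing_eq (hγ : 0 < γ) (hγ1 : γ ≤ 1 / 4) (hl : l = γ - γ ^ 3)
    (hv : ∀ x, HasDerivAt v (u x) x) (hu : ∀ x, HasDerivAt u (w x) x)
    (hw : ∀ x, HasDerivAt w (u x - 40 * yv x * (1 - yv x) * u x + l * v x) x)
    (h0 : Tendsto (fun x => v (-x) * LTd γ x - u (-x) * Td' γ x - w (-x) * Td γ x) atTop (nhds 0)) :
    v 0 * LTd γ 0 - u 0 * Td' γ 0 - w 0 * Td γ 0 = 0 := by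
  have hd : ∀ x,
      HasDerivAt (fun x => v (-x) * LTd γ x - u (-x) * Td' γ x - w (-x) * Td γ x) 0 x := by
    intro x
    have hv' := (hv (-x)).comp x (hasDerivAt_neg x)
    have hu' := (hu (-x)).comp x (hasDerivAt_neg x)
    have hw' := (hw (-x)).comp x (hasDerivAt_neg x)
    refine (((hv'.mul (hasDerivAt_LTd hγ hγ1 x)).sub (hu'.mul (hasDerivAt_Td' hγ hγ1 x))).sub
      (hw'.mul (hasDerivAt_Td hγ hγ1 x))).congr_deriv ?_
    simp only [Function.comp_apply, yv_neg, LTd, hl]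
    ring
  have hc : ∀ x, v (-x) * LTd γ x - u (-x) * Td' γ x - w (-x) * Td γ x
      = v (-0) * LTd γ 0 - u (-0) * Td' γ 0 - w (-0) * Td γ 0 := fun x =>
    is_const_of_deriv_eq_zero (fun x => (hd x).differentiableAt) (fun x => (hd x).deriv) x 0
  have := tendsto_nhds_unique h0 ((tendsto_congr hc).2 tendsto_const_nhds)
  simpa using this.symm

lemma tendsto_exp_div_Q :
    Tendsto (fun x => exp (-1 * x) / Q x) atTop (nhds ((1 / 10) ^ ((1:ℝ) / 3))) := by
  have h : ∀ x, exp (-1 * x) / Q x = (1 / (10 * (1 - yv x) ^ 2)) ^ ((1:ℝ) / 3) := fun x => by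
    have hq := Q_pos x
    have h1 := yv_lt_one x
    have h2 : 0 < 1 - yv x := by linarith
    have e : (exp (-1 * x) / Q x) ^ 3 = 1 / (10 * (1 - yv x) ^ 2) := by
      have h3 : exp (-1 * x) ^ 3 = exp (-3 * x) := by
        rw [← exp_nat_mul]; congr 1; push_cast; ring
      have h4 := yv_eq x
      rw [div_pow, h3, Q_cube, div_eq_div_iff (by have := yv_pos x; positivity) (by positivity)]
      linear_combination (-10 * (1 - yv x)) * h4
    rw [← e, ← rpow_natCast, ← rpow_mul (by positivity)]
    norm_num
  have ht : Tendsto (fun x => 1 / (10 * (1 - yv x) ^ 2)) atTop (nhds (1 / 10)) := by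
    have := (((tendsto_yv.const_sub 1).pow 2).const_mul 10).inv₀ (by norm_num)
    simpa using this
  exact (tendsto_congr h).2 (ht.rpow_const (Or.inl (by norm_num)))

/-- Bounds at the origin for the solution decaying like `e^{-(1-δ)x}`. -/
lemma value_bounds (hδ : 0 < δ) (hδ1 : δ ≤ 147 / 1000) (hl : l = δ * (1 - δ) * (2 - δ))
    (hv : ∀ x, HasDerivAt v (u x) x) (hu : ∀ x, HasDerivAt u (w x) x)
    (hw : ∀ x, HasDerivAt w (u x - 40 * yv x * (1 - yv x) * u x + l * v x) x) {b : ℝ} (hb0 : 0 < b)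
    (hb : Tendsto (fun x => v x * exp ((1 - δ) * x)) atTop (nhds b))
    (bu : ExpBigO (fun x => u x + (1 - δ) * v x) (-3))
    (bw : ExpBigO (fun x => w x + (1 - δ) * u x) (-3)) :
    0 < v 0 ∧ 0 ≤ u 0 ∧ u 0 ≤ l * (1 / 3 + 67 / 150 * δ) * v 0
      ∧ 28 / 100 * l * v 0 ≤ w 0 + 3 / 2 * v 0 := by
  have bv : ExpBigO v 0 := (ExpBigO.of_tendsto hb).mono (by linarith)
  have bu0 : ExpBigO u 0 := ((bu.mono (by norm_num)).sub (bv.const_mul (1 - δ))).congr_left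
    fun x => by ring
  have hq := fun x => (Q_pos x).ne'
  have hQi : ∀ x, HasDerivAt (fun x => (Q x)⁻¹) ((1 - 2 * yv x) * (Q x)⁻¹) x := fun x => by
    refine ((hasDerivAt_Q x).inv (hq x)).congr_deriv ?_
    field_simp [hq x]
  have key := right_bounds (h := fun x => v x * (Q x)⁻¹)
    (g := fun x => (u x + (1 - 2 * yv x) * v x) * (Q x)⁻¹)
    (n := fun x => (w x + 2 * (1 - 2 * yv x) * u x + (1 + 2 * yv x * (1 - yv x)) * v x) * (Q x)⁻¹)
    (b := b * (1 / 10) ^ ((1:ℝ) / 3)) hδ hδ1 hl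
    (fun x => ((hv x).mul (hQi x)).congr_deriv (by ring))
    (fun x => ((((hu x).add ((((hasDerivAt_yv x).const_mul 2).const_sub 1).mul (hv x)))).mul
      (hQi x)).congr_deriv (by simp only [Pi.add_apply, Pi.mul_apply]; ring))
    (fun x => by
      have hy := hasDerivAt_yv x
      refine ((((hw x).add ((((hy.const_mul 2).const_sub 1).const_mul 2).mul (hu x))).add
        ((((hy.const_mul 2).mul (hy.const_sub 1)).const_add 1).mul (hv x))).mul
          (hQi x)).congr_deriv ?_
      simp only [Pi.add_apply, Pi.mul_apply]
      ring)
    (by positivity) ?_ ?_ ?_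
  · have hq0 := Q_pos 0
    simp only [yv_zero] at key
    obtain ⟨k1, k2, k3, k4⟩ := key
    have e1 : v 0 = v 0 * (Q 0)⁻¹ * Q 0 := by field_simp
    have e2 : u 0 = (u 0 + (1 - 2 * (1 / 2)) * v 0) * (Q 0)⁻¹ * Q 0 := by field_simp; ring
    have e3 : w 0 + 3 / 2 * v 0 = (w 0 + 2 * (1 - 2 * (1 / 2)) * u 0
        + (1 + 2 * (1 / 2) * (1 - 1 / 2)) * v 0) * (Q 0)⁻¹ * Q 0 := by field_simp; ring
    refine ⟨by rw [e1]; positivity, by rw [e2]; positivity, ?_, ?_⟩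
    · calc _ = (u 0 + (1 - 2 * (1 / 2)) * v 0) * (Q 0)⁻¹ * Q 0 := e2
        _ ≤ l * (1 / 3 + 67 / 150 * δ) * (v 0 * (Q 0)⁻¹) * Q 0 :=
          mul_le_mul_of_nonneg_right k3 hq0.le
        _ = _ := by field_simp
    · rw [e3]
      calc _ = 28 / 100 * l * (v 0 * (Q 0)⁻¹) * Q 0 := by field_simp
        _ ≤ _ := mul_le_mul_of_nonneg_right k4 hq0.le
  · refine (hb.mul tendsto_exp_div_Q).congr fun x => ?_
    have e : exp (-δ * x) = exp ((1 - δ) * x) * exp (-1 * x) := by rw [← exp_add]; ring_nf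
    rw [e, div_eq_mul_inv]; ring
  · have c := expBigO_yv.mul bv
    rw [add_zero] at c
    have h := (bu.sub (c.const_mul 2)).mul expBigO_Q_inv
    norm_num at h
    exact h.congr_left fun x => by ring
  · have c0 := bv.mul expBigO_one_sub_yv
    rw [add_zero] at c0
    have c := expBigO_yv.mul (((c0.const_mul 2).sub (bu0.const_mul 4)).add (bv.const_mul (2 * δ)))
    rw [add_zero] at c
    have h := ((bw.add bu).add c).mul expBigO_Q_inv
    norm_num at h
    exact h.congr_left fun x => by ring

end Homogeneous

section Numerics

variable {γ : ℝ}

/-- The leading part of the pairing at the origin is positive. -/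
lemma pairing_lower_pos (hγ : 0 < γ) (hγ1 : γ ≤ 23 / 100) {p₀ p₁ p₂ c₁ c₂ c₃ : ℝ}
    (h0 : (1 + γ) * p₀ = 1) (h1 : (4 + γ) * p₁ = 2 * p₀ + c₁) (h2 : (3 + γ) * p₂ = c₂ + 5 * p₁)
    (hc1 : -5 + 343 / 100 * γ ≤ c₁) (hc2 : 289 / 100 - 235 / 100 * γ ≤ c₂)
    (hc3 : 476 / 1000 - 445 / 1000 * γ ≤ c₃) :
    0 < p₀ + p₁ / 2 + p₂ / 4 - 28 / 100 * (1 + c₁ / 2 + c₂ / 4 + 3 * c₃ / 16)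
      + (1 / 3 + 265 / 1000 * γ) * (γ * (1 + c₁ / 2 + c₂ / 4 + c₃ / 8)
        + 3 / 2 * (c₁ / 2 + c₂ / 2 + 3 * c₃ / 8)) := by
  have hD : 0 < (1 + γ) * (4 + γ) * (3 + γ) := by positivity
  refine pos_of_mul_pos_right ?_ hD.le
  have e : (1 + γ) * (4 + γ) * (3 + γ) * (p₀ + p₁ / 2 + p₂ / 4)
      = (3 + γ) * (4 + γ) + (3 + γ) / 2 * (2 + (1 + γ) * c₁) + (1 + γ) * (4 + γ) / 4 * c₂
        + 5 / 4 * (2 + (1 + γ) * c₁) := by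
    linear_combination ((3 + γ) * (4 + γ) + (3 + γ) + 5 / 2) * h0
      + ((1 + γ) * (3 + γ) / 2 + 5 / 4 * (1 + γ)) * h1 + (1 + γ) * (4 + γ) / 4 * h2
  have k1 : 0 ≤ (1 + γ) * ((3 + γ) / 2 + 5 / 4) * (c₁ - (-5 + 343 / 100 * γ))
      + (1 + γ) * (4 + γ) * (3 + γ) * (11 / 100 + (γ / 6 + 265 / 1000 * γ * (γ / 2 + 3 / 4)))
        * (c₁ - (-5 + 343 / 100 * γ)) := by
    have := sub_nonneg.2 hc1; positivity
  have k2 : 0 ≤ (1 + γ) * (4 + γ) / 4 * (c₂ - (289 / 100 - 235 / 100 * γ))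
      + (1 + γ) * (4 + γ) * (3 + γ) * (18 / 100 + (γ / 12 + 265 / 1000 * γ * (γ / 4 + 3 / 4)))
        * (c₂ - (289 / 100 - 235 / 100 * γ)) := by
    have := sub_nonneg.2 hc2; positivity
  have k3 : 0 ≤ (1 + γ) * (4 + γ) * (3 + γ) * (135 / 1000 + (γ / 24 + 265 / 1000 * γ *
      (γ / 8 + 9 / 16))) * (c₃ - (476 / 1000 - 445 / 1000 * γ)) := by
    have := sub_nonneg.2 hc3; positivity
  have k4 : 0 < 369352 / 100000 - 10543 / 1000 * γ - 3925 / 1000 * γ ^ 2 := by nlinarith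
  have k5 : 0 ≤ γ ^ 3 := by positivity
  have k6 : 0 ≤ γ ^ 4 := by positivity
  have k7 : 0 ≤ γ ^ 5 := by positivity
  have k8 : 0 ≤ γ ^ 6 := by positivity
  have k9 : 0 ≤ γ ^ 2 := by positivity
  linarith

lemma exists_pairing_coeffs (hγ : 0 < γ) (hγ1 : γ ≤ 23 / 100) :
    ∃ p₀ p₁ p₂, (1 + γ) * p₀ = 1 ∧ (4 + γ) * p₁ = 2 * p₀ + cf γ 1 ∧
      (3 + γ) * p₂ = cf γ 2 + 5 * p₁ ∧ p₂ ≤ 0 := by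
  have a0 : 0 < 1 + γ := by linarith
  have a1 : 0 < 4 + γ := by linarith
  have a2 : 0 < 3 + γ := by linarith
  refine ⟨1 / (1 + γ), (2 * (1 / (1 + γ)) + cf γ 1) / (4 + γ),
    (cf γ 2 + 5 * ((2 * (1 / (1 + γ)) + cf γ 1) / (4 + γ))) / (3 + γ),
    mul_div_cancel₀ _ a0.ne', mul_div_cancel₀ _ a1.ne', mul_div_cancel₀ _ a2.ne', ?_⟩
  refine div_nonpos_of_nonpos_of_nonneg ?_ a2.le
  have hc1 := cf_one_le hγ hγ1
  have hc2 : cf γ 2 ≤ -(6 / 10) * cf γ 1 := by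
    refine le_of_mul_le_mul_left ?_ (by positivity : 0 < (35 + 18 * γ + 3 * γ ^ 2) * (3 + γ))
    rw [cf_two_cf_one hγ]
    have hp : 0 ≤ 204 / 10 * γ + 286 / 30 * γ ^ 2 + 18 / 10 * γ ^ 3 := by positivity
    have := mul_nonneg hp (by linarith : 0 ≤ -cf γ 1)
    linarith
  have hp0 : 1 / (1 + γ) ≤ 1 := (div_le_one a0).2 (by linarith)
  have h3 : (2 * (1 / (1 + γ)) + cf γ 1) / (4 + γ) ≤ -(cf γ 2) / 5 := by
    rw [div_le_iff₀ a1]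
    have := mul_le_mul_of_nonneg_right hc2 a1.le
    nlinarith
  linarith

lemma pairing_zero_pos {v u w δ : ℝ} (hγ : 0 < γ) (hγ1 : γ ≤ 23 / 100)
    (hδ : δ ≤ 59 / 100 * γ) (hv : 0 < v) (hu : 0 ≤ u)
    (huv : u ≤ (γ - γ ^ 3) * (1 / 3 + 67 / 150 * δ) * v)
    (hwv : 28 / 100 * (γ - γ ^ 3) * v ≤ w + 3 / 2 * v) :
    0 < v * LTd γ 0 - u * Td' γ 0 - w * Td γ 0 := by
  obtain ⟨p₀, p₁, p₂, h0, h1, h2, hp⟩ := exists_pairing_coeffs hγ hγ1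
  have hI := pairing_lower_pos hγ hγ1 h0 h1 h2 (le_cf_one hγ hγ1) (le_cf_two hγ hγ1)
    (le_cf_three hγ hγ1)
  have hL := le_LTd_zero hγ hγ1 h0 h1 h2 hp
  have hT0 := Es_zero_zero_le hγ hγ1
  have hE0 := le_Es_zero hγ hγ1 (le_refl 0)
  have hE1 := le_Es_one_zero hγ hγ1
  have hc1 := cf_one_le hγ hγ1
  have hc2 := cf_two_le hγ hγ1
  have hc3 := (cf_three_bounds hγ hγ1).2
  have hl : 0 < γ - γ ^ 3 := by
    have : 0 < γ * (1 - γ ^ 2) := mul_pos hγ (by nlinarith)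
    linarith
  rw [yv_zero] at hE0
  have hT1 : Td' γ 0 ≤ -γ * (1 + cf γ 1 / 2 + cf γ 2 / 4 + cf γ 3 / 8)
      - 3 / 2 * (cf γ 1 / 2 + cf γ 2 / 2 + 3 * cf γ 3 / 8) := by
    rw [Td'_zero]
    have := mul_le_mul_of_nonneg_left hE0 hγ.le
    linarith
  have hT1' : 0 ≤ -γ * (1 + cf γ 1 / 2 + cf γ 2 / 4 + cf γ 3 / 8)
      - 3 / 2 * (cf γ 1 / 2 + cf γ 2 / 2 + 3 * cf γ 3 / 8) := by
    have : 0 ≤ γ * -(1 + cf γ 1 / 2 + cf γ 2 / 4 + cf γ 3 / 8) := mul_nonneg hγ.le (by linarith)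
    linarith
  rw [← Td_zero] at hT0
  have m1 := mul_le_mul_of_nonneg_left hL hv.le
  have m2 := (mul_le_mul_of_nonneg_left hT1 hu).trans
    (mul_le_mul_of_nonneg_right (huv.trans (mul_le_mul_of_nonneg_right
      (mul_le_mul_of_nonneg_left (by linarith : 1 / 3 + 67 / 150 * δ ≤ 1 / 3 + 265 / 1000 * γ)
        hl.le) hv.le)) hT1')
  have m3 : (w + 3 / 2 * v) * Td γ 0 ≤ 28 / 100 * (γ - γ ^ 3) * v
      * (1 + cf γ 1 / 2 + cf γ 2 / 4 + 3 * cf γ 3 / 16) := by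
    have n1 := mul_le_mul_of_nonpos_right hwv (by linarith : Td γ 0 ≤ 0)
    have n2 := mul_le_mul_of_nonneg_left hT0 (by positivity : 0 ≤ 28 / 100 * (γ - γ ^ 3) * v)
    exact n1.trans n2
  have m4 := mul_pos (mul_pos hl hv) hI
  linarith

end Numerics

section Main

variable {A A' A'' : ℝ → ℝ} {s γ l : ℝ}

lemma abs_bounded_of_integrable_sq {f f' : ℝ → ℝ} (hd : ∀ x, HasDerivAt f (f' x) x)
    (hc : Continuous f') (hf : Integrable fun x => f x ^ 2) (hf' : Integrable fun x => f' x ^ 2) :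
    ∃ C, ∀ x, |f x| ≤ C := by
  have cf : Continuous f := continuous_iff_continuousAt.2 fun x => (hd x).continuousAt
  have hI : Integrable fun x => f x ^ 2 + f' x ^ 2 := hf.add hf'
  refine ⟨f 0 ^ 2 + (∫ x, (f x ^ 2 + f' x ^ 2)) + 1, fun x => ?_⟩
  have h2 : ∀ x, HasDerivAt (fun x => f x ^ 2) (2 * f x * f' x) x := fun x =>
    ((hd x).pow 2).congr_deriv (by push_cast; ring)
  have h3 := intervalIntegral.integral_eq_sub_of_hasDerivAt (a := 0) (b := x) (fun y _ => h2 y)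
    ((by fun_prop : Continuous fun x => 2 * f x * f' x).intervalIntegrable _ _)
  have h4 : ‖∫ y in (0:ℝ)..x, 2 * f y * f' y‖ ≤ ∫ x, (f x ^ 2 + f' x ^ 2) := by
    refine intervalIntegral.norm_integral_le_integral_norm_uIoc.trans ?_
    refine le_trans (setIntegral_mono (g := fun x => f x ^ 2 + f' x ^ 2) ?_ hI.integrableOn
      fun y => ?_)
      (setIntegral_le_integral hI (ae_of_all _ fun y => by positivity))
    · exact ((by fun_prop : Continuous fun x => ‖2 * f x * f' x‖).intervalIntegrable 0 x).def'
    · rw [norm_eq_abs, abs_le]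
      constructor <;> nlinarith [sq_nonneg (f y + f' y), sq_nonneg (f y - f' y)]
  rw [h3, norm_eq_abs] at h4
  have h5 := (abs_le.1 h4).2
  have h6 : |f x| ≤ f x ^ 2 + 1 := by
    rw [← sq_abs]; nlinarith [sq_nonneg (|f x| - 1), abs_nonneg (f x)]
  linarith

lemma ExpBigO.of_bounded {f : ℝ → ℝ} (h : ∃ C, ∀ x, |f x| ≤ C) : ExpBigO f 0 := by
  obtain ⟨C, hC⟩ := h
  exact ExpBigO.of_le (C := C) fun x _ => by simpa using hC x

lemma false_of_fast_decay (hγ : 0 < γ) (hγ1 : γ ≤ 23 / 100) (hs : 866 / 1000 ≤ s) (hs1 : s < 1)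
    (hrel : s ^ 2 + s * γ + γ ^ 2 = 1) (hl : l = s * γ * (s + γ))
    (hA : ∀ x, HasDerivAt A (A' x) x) (hA' : ∀ x, HasDerivAt A' (A'' x) x)
    (hM : ∀ x, HasDerivAt (flux s A A'') (l * A x) x)
    (hbA : ∃ C, ∀ x, |A x| ≤ C) (hbA' : ∃ C, ∀ x, |A' x| ≤ C) (hbA'' : ∃ C, ∀ x, |A'' x| ≤ C)
    (bp : ExpBigO (fun x => A' x + s * A x) (-3)) {β : ℝ}
    (hβ : Tendsto (fun x => A x * exp (s * x)) atTop (nhds β)) : False := by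
  have hs0 : 0 < s := by linarith
  have hl1 : l = s * (1 - s ^ 2) := by rw [hl]; linear_combination s * hrel
  have hl2 : l = γ - γ ^ 3 := by rw [hl]; linear_combination γ * hrel
  have hl0 : 0 < l := by rw [hl]; positivity
  have bA := ExpBigO.of_bounded hbA
  have bA' := ExpBigO.of_bounded hbA'
  have bA'' := ExpBigO.of_bounded hbA''
  obtain ⟨v, hvdef⟩ : ∃ v : ℝ → ℝ,
      v = fun x => (4 * flux s A A'' x - (1 - s ^ 2) * exp (-s * x)) / l := ⟨_, rfl⟩
  obtain ⟨u, hudef⟩ : ∃ u : ℝ → ℝ, u = fun x => 4 * A x + exp (-s * x) := ⟨_, rfl⟩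
  obtain ⟨w, hwdef⟩ : ∃ w : ℝ → ℝ, w = fun x => 4 * A' x - s * exp (-s * x) := ⟨_, rfl⟩
  have he := hasDerivAt_exp_mul_left (-s)
  have hv : ∀ x, HasDerivAt v (u x) x := fun x => by
    rw [hvdef, hudef]
    refine ((((hM x).const_mul 4).sub ((he x).const_mul (1 - s ^ 2))).div_const l).congr_deriv ?_
    rw [div_eq_iff hl0.ne']
    linear_combination (-exp (-s * x)) * hl1
  have hu : ∀ x, HasDerivAt u (w x) x := fun x => by
    rw [hudef, hwdef]
    refine (((hA x).const_mul 4).add (he x)).congr_deriv ?_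
    ring
  have hw : ∀ x, HasDerivAt w (u x - 40 * yv x * (1 - yv x) * u x + l * v x) x := fun x => by
    rw [hwdef]
    refine (((hA' x).const_mul 4).sub ((he x).const_mul s)).congr_deriv ?_
    simp only [hudef, hvdef]
    rw [mul_div_cancel₀ _ hl0.ne']
    simp only [flux, Q_cube]
    ring
  have hb : Tendsto (fun x => u x * exp (s * x)) atTop (nhds (4 * β + 1)) := by
    refine ((hβ.const_mul 4).add_const 1).congr fun x => ?_
    have : exp (-s * x) * exp (s * x) = 1 := by rw [← exp_add]; simp
    simp only [hudef]; linear_combination -this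
  by_cases hb0 : 4 * β + 1 = 0
  · rw [hb0] at hb
    obtain ⟨X, hX⟩ := eventually_zero_of_tail hγ (by linarith) hs1.le hrel hl hA hA' hM bA bA' bA''
      bp (by simpa only [hudef] using hb)
    have hu0 : ∀ x, X ≤ x → u x = 0 := fun x hx => by rw [hudef]; exact hX x hx
    have hw0 : ∀ x, X < x → w x = 0 := fun x hx => by
      refine (hu x).unique ((hasDerivAt_const x (0:ℝ)).congr_of_eventuallyEq ?_)
      filter_upwards [lt_mem_nhds hx] with z hz using hu0 z hz.le
    have hv0 : v (X + 1) = 0 := by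
      have h := (hw (X + 1)).unique ((hasDerivAt_const (X + 1) (0:ℝ)).congr_of_eventuallyEq
        (by filter_upwards [lt_mem_nhds (lt_add_one X)] with z hz using hw0 z hz))
      rw [hu0 _ (lt_add_one X).le] at h
      simpa [hl0.ne'] using h
    have hul : ∀ x, x ≤ X + 1 → u x = 0 := fun x hx =>
      eq_zero_of_eq_zero_right (abs_le.2 ⟨by linarith, by nlinarith [pow_pos hγ 3]⟩) hv hu hw hv0
        (hu0 _ (lt_add_one X).le) (hw0 _ (lt_add_one X)) hx
    obtain ⟨C, hC⟩ := hbA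
    have ht : Tendsto (fun x => exp (s * x)) atTop atTop :=
      tendsto_exp_atTop.comp (tendsto_id.const_mul_atTop hs0)
    obtain ⟨x, hx1, hx2⟩ := ((ht.eventually_gt_atTop (4 * C)).and
      (eventually_ge_atTop (-(X + 1)))).exists
    have h1 := hul (-x) (by linarith)
    have h2 := (abs_le.1 (hC (-x))).1
    simp only [hudef, neg_mul_neg] at h1
    linarith
  · have bAs : ExpBigO A (-s) := ExpBigO.of_tendsto hβ
    have bA's : ExpBigO A' (-s) := ((bp.mono (by linarith)).sub (bAs.const_mul s)).congr_left
      fun x => by ring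
    have bA''s : ExpBigO A'' (-s) :=
      ((((expBigO_outgoing hγ hs0 hrel hl hA hA' hM bA bA' bA'').mono (by linarith)).sub
        (bA's.const_mul (s + γ))).sub (bAs.const_mul (s * γ))).congr_left fun x => by ring
    have bus : ExpBigO u (-s) := by rw [hudef]; exact (bAs.const_mul 4).add (expBigO_exp _)
    have bvs : ExpBigO v (-s) := by
      have h1 : ExpBigO (flux s A A'') (-s) :=
        (bA''s.sub bAs).add ((expBigO_Q_cube.mul ((bA.const_mul 4).add
          ((expBigO_exp (-s)).mono (by linarith)))).mono (by linarith))
      rw [hvdef]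
      refine (((h1.const_mul 4).sub ((expBigO_exp (-s)).const_mul (1 - s ^ 2))).const_mul
        (1 / l)).congr_left fun x => ?_
      ring
    have bws : ExpBigO (fun x => w x + s * u x) (-3) := (bp.const_mul 4).congr_left fun x => by
      simp only [hwdef, hudef]; ring
    have bus3 : ExpBigO (fun x => u x + s * v x) (-3) := by
      refine ExpBigO.of_linear_ode (a := 0) (by norm_num)
        (fun x => ((hu x).add ((hv x).const_mul s)).congr_deriv (by ring)) bws ?_
      have := (bus.add (bvs.const_mul s)).tendsto_zero (by linarith)
      simpa using this
    have hvlim : Tendsto (fun x => v x * exp (s * x)) atTop (nhds (-(4 * β + 1) / s)) := by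
      have h1 := (bus3.mul (expBigO_exp s)).tendsto_zero (by linarith)
      have h2 := (h1.sub hb).div_const s
      rw [zero_sub] at h2
      refine h2.congr fun x => ?_
      field_simp
      ring
    have hK : v 0 * LTd γ 0 - u 0 * Td' γ 0 - w 0 * Td γ 0 = 0 := by
      have hγ4 : γ ≤ 1 / 4 := by linarith
      refine pairing_eq hγ hγ4 hl2 hv hu hw ?_
      have bT := expBigO_Td_sub hγ hγ4
      have bT' := expBigO_Td'_add hγ hγ4
      have bY := expBigO_LTd_sub hγ hγ4
      have rA : ExpBigO (fun x => A (-x)) 0 := ExpBigO.of_bounded (hbA.imp fun C hC x => hC (-x))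
      have rA' : ExpBigO (fun x => A' (-x)) 0 := ExpBigO.of_bounded (hbA'.imp fun C hC x => hC (-x))
      have rM : ExpBigO (fun x => flux s A A'' (-x)) 0 := by
        have rA'' : ExpBigO (fun x => A'' (-x)) 0 :=
          ExpBigO.of_bounded (hbA''.imp fun C hC x => hC (-x))
        have rB := expBigO_Q_cube.mul (((rA.const_mul 4).mono hs0.le).add (expBigO_exp s))
        refine ((rA''.sub rA).add (rB.mono (by linarith))).congr_left fun x => ?_
        simp only [flux, Q_cube, yv_neg, neg_mul_neg]
        ring
      have sT : ExpBigO (Td γ) (-γ) := ((bT.mono (by linarith)).add (expBigO_exp (-γ))).congr_left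
        fun x => by ring
      have sT' : ExpBigO (Td' γ) (-γ) :=
        ((bT'.mono (by linarith)).sub ((expBigO_exp (-γ)).const_mul γ)).congr_left fun x => by ring
      have sY : ExpBigO (LTd γ) (-γ) :=
        ((bY.mono (by linarith)).add ((expBigO_exp (-γ)).const_mul (1 - γ ^ 2))).congr_left
          fun x => by ring
      have t1 := ((((rM.mul sY).const_mul (4 / l)).sub ((rA.mul sT').const_mul 4)).sub
        ((rA'.mul sT).const_mul 4)).tendsto_zero (by linarith)
      have t2 := ((expBigO_exp s).mul (((bY.const_mul (-(1 / s))).sub bT').add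
        (bT.const_mul s))).tendsto_zero (by linarith)
      have t3 := t1.add t2
      rw [add_zero] at t3
      refine t3.congr fun x => ?_
      simp only [hvdef, hudef, hwdef, neg_mul_neg]
      have hq : 1 - s ^ 2 = l / s := by rw [hl1]; field_simp
      rw [hq]
      generalize exp (s * x) = a
      generalize exp (-γ * x) = b
      field_simp
      linear_combination (-l * a * b) * hrel
    have hb2 : 0 < -(4 * β + 1) * (-(4 * β + 1) / s) := by
      rw [← mul_div_assoc, neg_mul_neg]
      exact div_pos (mul_self_pos.2 hb0) hs0
    have hds : 1 - (1 - s) = s := by ring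
    obtain ⟨k1, k2, k3, k4⟩ := value_bounds (v := fun x => -(4 * β + 1) * v x)
      (u := fun x => -(4 * β + 1) * u x) (w := fun x => -(4 * β + 1) * w x) (δ := 1 - s) (l := l)
      (by linarith) (by linarith) (by rw [hl1]; ring) (fun x => (hv x).const_mul _)
      (fun x => (hu x).const_mul _) (fun x => ((hw x).const_mul _).congr_deriv (by ring)) hb2
      (by rw [hds]; exact (hvlim.const_mul _).congr fun x => by ring)
      (by rw [hds]; exact (bus3.const_mul (-(4 * β + 1))).congr_left fun x => by ring)
      (by rw [hds]; exact (bws.const_mul (-(4 * β + 1))).congr_left fun x => by ring)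
    have hδγ : 1 - s ≤ 59 / 100 * γ := by
      have h1 : 41 / 100 * s + γ ≤ 59 / 100 := by nlinarith
      have h2 : (1 - s) * (1 + s) ≤ 59 / 100 * γ * (1 + s) := by nlinarith
      exact le_of_mul_le_mul_right h2 (by linarith)
    rw [hl2] at k3 k4
    have := pairing_zero_pos hγ hγ1 hδγ k1 k2 k3 k4
    have hz : -(4 * β + 1) * (v 0 * LTd γ 0 - u 0 * Td' γ 0 - w 0 * Td γ 0) = 0 := by
      rw [hK, mul_zero]
    linarith

end Main

/-- Generic exponential decay on the right: for `3/4 ≤ c < 1`, the limit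
`a_c^I = lim_{x→+∞} A_c(x) e^{γ_c^I x}` exists and is nonzero. -/
theorem generic_decay_Ac (c : ℝ) (hc : 3 / 4 ≤ c) (hc1 : c < 1)
    (A : ℝ → ℝ) (hA : IsAc c A) :
    ∃ a : ℝ, a ≠ 0 ∧
      Tendsto (fun x => A x
          * Real.exp ((Real.sqrt (1 - 3 / 4 * c) - 1 / 2 * Real.sqrt c) * x))
        atTop (nhds a) := by
  obtain ⟨hsm, hsqi, heq⟩ := hA
  obtain ⟨s, hs⟩ : ∃ s, s = √c := ⟨_, rfl⟩
  obtain ⟨γ, hγdef⟩ : ∃ γ, γ = √(1 - 3 / 4 * c) - 1 / 2 * s := ⟨_, rfl⟩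
  rw [← hs] at heq ⊢
  rw [← hγdef]
  have hs0 : 0 ≤ s := by rw [hs]; exact sqrt_nonneg _
  have hsq : s ^ 2 = c := by rw [hs]; exact sq_sqrt (by linarith)
  have hs1 : s < 1 := by nlinarith
  have hs2 : 866 / 1000 ≤ s := by nlinarith
  have hr2 : (γ + 1 / 2 * s) ^ 2 = 1 - 3 / 4 * c := by
    rw [hγdef, sub_add_cancel, sq_sqrt (by linarith)]
  have hr0 : 0 ≤ γ + 1 / 2 * s := by rw [hγdef, sub_add_cancel]; exact sqrt_nonneg _
  have hrel : s ^ 2 + s * γ + γ ^ 2 = 1 := by linear_combination hr2 + 3 / 4 * hsq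
  have hγ : 0 < γ := by nlinarith
  have hγ1 : γ ≤ 23 / 100 := by nlinarith
  obtain ⟨l, hl⟩ : ∃ l, l = s * γ * (s + γ) := ⟨_, rfl⟩
  have hlc : s * (1 - c) = l := by rw [hl, ← hsq]; linear_combination (-s) * hrel
  rw [hlc] at heq
  have hder : ∀ k : ℕ, ∀ x, HasDerivAt (iteratedDeriv k A) (iteratedDeriv (k + 1) A x) x := by
    intro k x
    rw [iteratedDeriv_succ]
    exact (hsm.differentiable_iteratedDeriv k
      (by exact_mod_cast WithTop.coe_lt_top _) x).hasDerivAt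
  have hcont : ∀ k : ℕ, Continuous (iteratedDeriv k A) := fun k =>
    continuous_iff_continuousAt.2 fun x => (hder k x).continuousAt
  have hbd : ∀ k : ℕ, k ≤ 9 → ∃ C, ∀ x, |iteratedDeriv k A x| ≤ C := fun k hk =>
    abs_bounded_of_integrable_sq (hder k) (hcont _) (hsqi k (by omega)) (hsqi (k + 1) (by omega))
  have hA0 : ∀ x, HasDerivAt A (iteratedDeriv 1 A x) x := by simpa using hder 0
  have hbA : ∃ C, ∀ x, |A x| ≤ C := by simpa using hbd 0 (by norm_num)
  have hM : ∀ x, HasDerivAt (flux s A (iteratedDeriv 2 A)) (l * A x) x := fun x => by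
    have hQ3 := (hasDerivAt_Q x).pow 3
    have hL : DifferentiableAt ℝ (LQ A) x :=
      (((hder 2 x).neg.add (hA0 x)).sub ((hQ3.const_mul 4).mul (hA0 x))).differentiableAt
    have hF : DifferentiableAt ℝ (fun y => exp (-s * y) * Q y ^ 3) x :=
      ((hasDerivAt_exp_mul_left (-s) x).mul hQ3).differentiableAt
    have h := hF.hasDerivAt.sub hL.hasDerivAt
    rw [← heq x, add_sub_cancel_left] at h
    refine h.congr_of_eventuallyEq (Eventually.of_forall fun y => ?_)
    simp only [flux, LQ, Pi.sub_apply]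
    ring
  obtain ⟨α, hα, hα0⟩ := exists_tendsto_right hγ (by linarith) hs1.le hrel hl hA0 (hder 1)
    (hcont 2) hM (ExpBigO.of_bounded hbA) (ExpBigO.of_bounded (hbd 1 (by norm_num)))
    (ExpBigO.of_bounded (hbd 2 (by norm_num)))
  refine ⟨α, fun h => ?_, hα⟩
  obtain ⟨bp, β, hβ⟩ := hα0 h
  exact false_of_fast_decay hγ hγ1 hs2 hs1 hrel hl hA0 (hder 1) hM hbA (hbd 1 (by norm_num))
    (hbd 2 (by norm_num)) bp hβ
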